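/- Suppose m ≥ n > 2 and define t_n = Σ_{A ⊆ [m], |A| = n} r_A. Then VR(F^m_{≤n}, 2) ≃ ( ∨_{t_n} S³ ) ∨ VR(F^m_{≤n−1}, 2). Consequently, VR(F^m_{≤n}, 2) is homotopy equivalent to a wedge sum of Σ_{k=3}^{n} t_k copies of the 3-sphere S³. -/

import Mathlib

open Finset

/-- An abstract simplicial complex on a vertex type `V`: a collection of nonempty
finite subsets of `V` (the faces), closed under taking nonempty subsets. -/
structure AbsSC (V : Type) where
  faces : Set (Finset V)
  not_empty_mem : ∅ ∉ faces
  down_closed : ∀ s ∈ faces, ∀ t : Finset V, t ⊆ s → t ≠ ∅ → t ∈ faces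

namespace AbsSC

variable {V W : Type}

/-- The vertex set of a simplicial complex. -/
def vertices (K : AbsSC V) : Set V := {v | ({v} : Finset V) ∈ K.faces}

/-- The geometric realization of a simplicial complex: the space of convex weightings
supported on a face, topologized as a subspace of `V → ℝ`. -/
def space (K : AbsSC V) : Type :=
  {f : V → ℝ // (∀ v, 0 ≤ f v) ∧ ∃ s ∈ K.faces, (∀ v, f v ≠ 0 → v ∈ s) ∧ ∑ v ∈ s, f v = 1}

instance (K : AbsSC V) : TopologicalSpace K.space := by unfold space; infer_instance

/-- `L` is a subcomplex of `K`. -/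
def IsSubcomplex (L K : AbsSC V) : Prop := L.faces ⊆ K.faces

/-- Homotopy equivalence of simplicial complexes (of their geometric realizations). -/
def HEquiv (K : AbsSC V) (L : AbsSC W) : Prop :=
  Nonempty (ContinuousMap.HomotopyEquiv K.space L.space)

/-- The realization of `K` is homotopy equivalent to the topological space `X`. -/
def HEquivTop (K : AbsSC V) (X : Type) [TopologicalSpace X] : Prop :=
  Nonempty (ContinuousMap.HomotopyEquiv K.space X)

/-- The inclusion of realizations induced by a subcomplex inclusion. -/
def incl {L K : AbsSC V} (h : L.faces ⊆ K.faces) : C(L.space, K.space) where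
  toFun f := ⟨f.1, f.2.1, by obtain ⟨s, hs, h1, h2⟩ := f.2.2; exact ⟨s, h hs, h1, h2⟩⟩
  continuous_toFun := Continuous.subtype_mk continuous_subtype_val _

variable [DecidableEq V]

/-- The link of a vertex. -/
def link (K : AbsSC V) (v : V) : AbsSC V where
  faces := {σ | σ ≠ ∅ ∧ v ∉ σ ∧ σ ∪ {v} ∈ K.faces}
  not_empty_mem h := h.1 rfl
  down_closed := by
    rintro s ⟨hne, hv, hs⟩ t hts htne
    exact ⟨htne, fun hvt => hv (hts hvt),
      K.down_closed _ hs _ (Finset.union_subset_union hts (Finset.Subset.refl _)) (by simp [Finset.union_eq_empty])⟩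

lemma link_subset (K : AbsSC V) (v : V) : (K.link v).faces ⊆ K.faces := by
  rintro σ ⟨hne, hv, hσ⟩
  exact K.down_closed _ hσ _ Finset.subset_union_left hne

/-- The complex induced on the vertices other than `v`. -/
def delete (K : AbsSC V) (v : V) : AbsSC V where
  faces := {σ | σ ∈ K.faces ∧ v ∉ σ}
  not_empty_mem h := K.not_empty_mem h.1
  down_closed := by
    rintro s ⟨hs, hv⟩ t hts htne
    exact ⟨K.down_closed _ hs _ hts htne, fun h => hv (hts h)⟩

/-- The star of a vertex: `st_K(v) = {σ : σ ∪ {v} ∈ K}`. -/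
def star (K : AbsSC V) (v : V) : AbsSC V where
  faces := {σ | σ ≠ ∅ ∧ σ ∪ {v} ∈ K.faces}
  not_empty_mem h := h.1 rfl
  down_closed := by
    rintro s ⟨hne, hs⟩ t hts htne
    exact ⟨htne,
      K.down_closed _ hs _ (Finset.union_subset_union hts (Finset.Subset.refl _)) (by simp [Finset.union_eq_empty])⟩

/-- The star cluster of a subcomplex `L` in `K`: the union of stars of vertices of `L`. -/
def starCluster (K L : AbsSC V) : AbsSC V where
  faces := {σ | σ ≠ ∅ ∧ ∃ v, ({v} : Finset V) ∈ L.faces ∧ σ ∪ {v} ∈ K.faces}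
  not_empty_mem h := h.1 rfl
  down_closed := by
    rintro s ⟨hne, v, hvL, hs⟩ t hts htne
    exact ⟨htne, v, hvL,
      K.down_closed _ hs _ (Finset.union_subset_union hts (Finset.Subset.refl _)) (by simp [Finset.union_eq_empty])⟩

/-- The union of two simplicial complexes. -/
def union (K₁ K₂ : AbsSC V) : AbsSC V where
  faces := K₁.faces ∪ K₂.faces
  not_empty_mem h := by
    rcases h with h | h
    exacts [K₁.not_empty_mem h, K₂.not_empty_mem h]
  down_closed := by
    rintro s (hs | hs) t hts htne
    exacts [Or.inl (K₁.down_closed _ hs _ hts htne), Or.inr (K₂.down_closed _ hs _ hts htne)]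

/-- The union of a family of simplicial complexes. -/
def iUnionC {ι : Type} (F : ι → AbsSC V) : AbsSC V where
  faces := ⋃ i, (F i).faces
  not_empty_mem h := by
    obtain ⟨i, hi⟩ := Set.mem_iUnion.mp h
    exact (F i).not_empty_mem hi
  down_closed := by
    intro s hs t hts htne
    obtain ⟨i, hi⟩ := Set.mem_iUnion.mp hs
    exact Set.mem_iUnion.mpr ⟨i, (F i).down_closed _ hi _ hts htne⟩

/-- The `n`-skeleton of a complex: all faces with at most `n+1` vertices. -/
def skeleton (K : AbsSC V) (n : ℕ) : AbsSC V where
  faces := {σ | σ ∈ K.faces ∧ σ.card ≤ n + 1}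
  not_empty_mem h := K.not_empty_mem h.1
  down_closed := by
    rintro s ⟨hs, hcard⟩ t hts htne
    exact ⟨K.down_closed _ hs _ hts htne, le_trans (Finset.card_le_card hts) hcard⟩

/-- The simplicial complex generated by a single simplex `s` (all its nonempty subsets). -/
def simplexCx (s : Finset V) : AbsSC V where
  faces := {t | t ≠ ∅ ∧ t ⊆ s}
  not_empty_mem h := h.1 rfl
  down_closed := by
    rintro a ⟨hne, has⟩ t hta htne
    exact ⟨htne, hta.trans has⟩

/-- A maximal simplex (facet) of `K`. -/
def IsFacet (K : AbsSC V) (σ : Finset V) : Prop :=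
  σ ∈ K.faces ∧ ∀ τ ∈ K.faces, σ ⊆ τ → τ = σ

/-- `K` is a clique complex: any nonempty set of vertices which pairwise span edges is a face. -/
def IsCliqueCx (K : AbsSC V) : Prop :=
  ∀ σ : Finset V, σ ≠ ∅ → (∀ v ∈ σ, ({v} : Finset V) ∈ K.faces) →
    (∀ v ∈ σ, ∀ w ∈ σ, v ≠ w → ({v, w} : Finset V) ∈ K.faces) → σ ∈ K.faces

/-- `L` is a full subcomplex of `K`. -/
def IsFull (L K : AbsSC V) : Prop :=
  ∀ σ ∈ K.faces, (∀ v ∈ σ, ({v} : Finset V) ∈ L.faces) → σ ∈ L.faces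

end AbsSC

noncomputable section

/-- The `n`-dimensional sphere. -/
abbrev Sph (n : ℕ) : Type := Metric.sphere (0 : EuclideanSpace ℝ (Fin (n + 1))) 1

/-- A base point on the sphere. -/
def sphBase (n : ℕ) : Sph n :=
  ⟨EuclideanSpace.single 0 1, by simp⟩

/-- Relation gluing the base points of `c` copies of a pointed space to an auxiliary point. -/
inductive wedgeRel (c : ℕ) (X : Type) (x₀ : X) : Unit ⊕ Fin c × X → Unit ⊕ Fin c × X → Prop
  | glue (i : Fin c) : wedgeRel c X x₀ (Sum.inl ()) (Sum.inr (i, x₀))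

/-- The wedge sum of `c` copies of the pointed space `(X, x₀)`. -/
def Wedge (c : ℕ) (X : Type) [TopologicalSpace X] (x₀ : X) : Type := Quot (wedgeRel c X x₀)

instance (c : ℕ) (X : Type) [TopologicalSpace X] (x₀ : X) : TopologicalSpace (Wedge c X x₀) := by
  unfold Wedge; infer_instance

/-- The base point of the wedge. -/
def wedgePt (c : ℕ) (X : Type) [TopologicalSpace X] (x₀ : X) : Wedge c X x₀ :=
  Quot.mk _ (Sum.inl ())

/-- The wedge sum of `c` copies of the `n`-sphere. -/
abbrev WedgeSph (n c : ℕ) : Type := Wedge c (Sph n) (sphBase n)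

/-- The base point of a wedge of spheres. -/
def wedgeSphPt (n c : ℕ) : WedgeSph n c := wedgePt c _ _

/-- Relation gluing the two base points in a binary wedge. -/
inductive wedge2Rel (X Y : Type) (x₀ : X) (y₀ : Y) : X ⊕ Y → X ⊕ Y → Prop
  | glue : wedge2Rel X Y x₀ y₀ (Sum.inl x₀) (Sum.inr y₀)

/-- The wedge sum `X ∨ Y` of two pointed spaces. -/
def Wedge2 (X Y : Type) [TopologicalSpace X] [TopologicalSpace Y] (x₀ : X) (y₀ : Y) : Type :=
  Quot (wedge2Rel X Y x₀ y₀)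

instance (X Y : Type) [TopologicalSpace X] [TopologicalSpace Y] (x₀ : X) (y₀ : Y) :
    TopologicalSpace (Wedge2 X Y x₀ y₀) := by unfold Wedge2; infer_instance

/-- Relation collapsing the top and bottom of the cylinder `X × [0,1]` to two cone points. -/
inductive suspRel (X : Type) : X × unitInterval ⊕ Bool → X × unitInterval ⊕ Bool → Prop
  | zero (x : X) : suspRel X (Sum.inl (x, 0)) (Sum.inr false)
  | one (x : X) : suspRel X (Sum.inl (x, 1)) (Sum.inr true)

/-- The (unreduced) suspension `Σ X`. -/
def Susp (X : Type) [TopologicalSpace X] : Type := Quot (suspRel X)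

instance (X : Type) [TopologicalSpace X] : TopologicalSpace (Susp X) := by
  unfold Susp; infer_instance

/-- The north cone point of the suspension. -/
def suspNorth (X : Type) [TopologicalSpace X] : Susp X := Quot.mk _ (Sum.inr true)

end

/-- The Vietoris–Rips complex at scale `r` of a collection `F` of finite subsets of `ℕ`,
with respect to the symmetric difference metric `d(A,B) = |A Δ B|`. -/
def VRc (F : Set (Finset ℕ)) (r : ℕ) : AbsSC (Finset ℕ) where
  faces := {σ | σ.Nonempty ∧ (∀ A ∈ σ, A ∈ F) ∧
    ∀ A ∈ σ, ∀ B ∈ σ, (symmDiff A B).card ≤ r}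
  not_empty_mem h := by simpa using h.1
  down_closed := by
    rintro s ⟨hne, hF, hd⟩ t hts htne
    exact ⟨Finset.nonempty_iff_ne_empty.mpr htne, fun A hA => hF A (hts hA),
      fun A hA B hB => hd A (hts hA) B (hts hB)⟩

/-- `F_n^m`: all `n`-element subsets of `[m] = {1, …, m}`. -/
def Fnm (m n : ℕ) : Set (Finset ℕ) := {A | A ⊆ Finset.Icc 1 m ∧ A.card = n}

/-- `F_{≤ n}^m`: all subsets of `[m]` of cardinality at most `n`. -/
def Fle (m n : ℕ) : Set (Finset ℕ) := {A | A ⊆ Finset.Icc 1 m ∧ A.card ≤ n}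

/-- The simplex `N[C] = {A : C ⊆ A, |A \ C| = 1}` inside `[m]`. -/
def NSimp (m : ℕ) (C : Finset ℕ) : Finset (Finset ℕ) :=
  (Finset.Icc 1 m \ C).image (fun x => insert x C)

/-- The simplex `L[S]`: all subsets of `S` obtained by removing one element. -/
def LSimp (S : Finset ℕ) : Finset (Finset ℕ) := S.image (fun x => S.erase x)

/-- The total order `≺`: first compare cardinalities, then compare the increasing
enumerations lexicographically. -/
def precLT (A B : Finset ℕ) : Prop :=
  A.card < B.card ∨
    (A.card = B.card ∧ List.Lex (· < ·) (A.sort (· ≤ ·)) (B.sort (· ≤ ·)))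

/-- `A ⪯ B`. -/
def precLE (A B : Finset ℕ) : Prop := precLT A B ∨ A = B

/-- `F^m_{≺ A}`: all subsets of `[m]` strictly preceding `A`. -/
def FprecLT (m : ℕ) (A : Finset ℕ) : Set (Finset ℕ) :=
  {B | B ⊆ Finset.Icc 1 m ∧ precLT B A}

/-- `F^m_{⪯ A}`: all subsets of `[m]` preceding (or equal to) `A`. -/
def FprecLE (m : ℕ) (A : Finset ℕ) : Set (Finset ℕ) :=
  {B | B ⊆ Finset.Icc 1 m ∧ precLE B A}

/-- The `j`-th value (0-indexed) of an enumeration `i : Fin n → ℕ`. -/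
def ith {n : ℕ} (i : Fin n → ℕ) (j : ℕ) : ℕ := if h : j < n then i ⟨j, h⟩ else 0

/-- The `ℓ`-th entry (1-indexed) of the enumeration, as an integer, with `i_0 = -1`. -/
def ivZ {n : ℕ} (i : Fin n → ℕ) (ℓ : ℕ) : ℤ := if ℓ = 0 then -1 else (ith i (ℓ - 1) : ℤ)

/-- For `B = i_1 i_2 ⋯ i_n` (increasing), with `d_1 = i_1` and
`d_ℓ = i_ℓ - (i_{ℓ-1} + 1)`, `r_B = Σ_{k=2}^{n-2} C(k,2) + Σ_{ℓ=1}^{n-2} d_ℓ·C(n-ℓ,2)`. -/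
def rA (B : Finset ℕ) : ℕ :=
  (∑ k ∈ Finset.Icc 2 (B.card - 2), Nat.choose k 2) +
    ∑ ℓ ∈ Finset.Icc 1 (B.card - 2),
      ((B.sort (· ≤ ·)).getD (ℓ - 1) 0 -
        (if ℓ = 1 then 0 else (B.sort (· ≤ ·)).getD (ℓ - 2) 0 + 1)) * Nat.choose (B.card - ℓ) 2

/-- For `B = i_1 i_2 ⋯ i_n` (increasing), with `c_1 = i_1 - 1` and
`c_ℓ = i_ℓ - (i_{ℓ-1} + 1)`, `s_B = Σ_{k=2}^{n-2} C(k,2) + Σ_{ℓ=1}^{n-2} c_ℓ·C(n-ℓ,2)`. -/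
def sA (B : Finset ℕ) : ℕ :=
  (∑ k ∈ Finset.Icc 2 (B.card - 2), Nat.choose k 2) +
    ∑ ℓ ∈ Finset.Icc 1 (B.card - 2),
      ((B.sort (· ≤ ·)).getD (ℓ - 1) 0 -
        (if ℓ = 1 then 1 else (B.sort (· ≤ ·)).getD (ℓ - 2) 0 + 1)) * Nat.choose (B.card - ℓ) 2

/-- `t_n = Σ_{A ⊆ [m], |A| = n} r_A`. -/
def tN (m n : ℕ) : ℕ :=
  ∑ A ∈ (Finset.Icc 1 m).powerset.filter (fun A => A.card = n), rA A

/-- `o_{m,n} = Σ { s_A : A ∈ F^m_{n+2}, min A ≥ 2 }`. -/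
def omn (m n : ℕ) : ℕ :=
  ∑ A ∈ (Finset.Icc 1 m).powerset.filter (fun A => A.card = n + 2 ∧ ∀ x ∈ A, 2 ≤ x), sA A

section Building

variable {V : Type} [DecidableEq V]

/-- `Y` arises from `X` by adding a cell `σ` and a cell `insert v σ` of which `σ` is a free
face. -/
def ElemExp (X Y : Set (Finset V)) : Prop :=
  ∃ (σ : Finset V) (v : V), v ∉ σ ∧ σ ∉ X ∧ insert v σ ∉ X ∧
    (∀ ρ ⊆ insert v σ, ρ ≠ σ → ρ ≠ insert v σ → ρ ∈ X) ∧ Y = X ∪ {σ, insert v σ}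

/-- `Built d B t X`: the family of cells `X` arises from `B` by elementary expansions and by
attaching `t` cells with `d` vertices along their full boundaries. -/
inductive Built (d : ℕ) (B : Set (Finset V)) : ℕ → Set (Finset V) → Prop
  | base : Built d B 0 B
  | expand {t : ℕ} {X Y : Set (Finset V)} : Built d B t X → ElemExp X Y → Built d B t Y
  | attach {t : ℕ} {X : Set (Finset V)} {τ : Finset V} : Built d B t X → τ ∉ X →
      (∀ ρ ⊂ τ, ρ ∈ X) → τ.card = d → Built d B (t + 1) (X ∪ {τ})

namespace Built

variable {d : ℕ} {B X Y Z : Set (Finset V)}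

lemma trans {s t : ℕ} (h₁ : Built d B s X) (h₂ : Built d X t Y) : Built d B (s + t) Y := by
  induction h₂ with
  | base => exact h₁
  | expand _ hE ih => exact ih.expand hE
  | attach _ hτ hb hc ih => exact ih.attach hτ hb hc

lemma subset {t : ℕ} (h : Built d B t X) : B ⊆ X := by
  induction h with
  | base => exact subset_rfl
  | expand _ hE ih =>
    obtain ⟨σ, v, -, -, -, -, rfl⟩ := hE
    exact ih.trans Set.subset_union_left
  | attach _ _ _ _ ih => exact ih.trans Set.subset_union_left

lemma finite {t : ℕ} (h : Built d B t X) (hB : B.Finite) : X.Finite := by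
  induction h with
  | base => exact hB
  | expand _ hE ih =>
    obtain ⟨σ, v, -, -, -, -, rfl⟩ := hE
    exact ih.union (Set.toFinite _)
  | attach _ _ _ _ ih => exact ih.union (Set.toFinite _)

lemma isLowerSet {t : ℕ} (h : Built d B t X) (hB : IsLowerSet B) : IsLowerSet X := by
  induction h with
  | base => exact hB
  | expand _ hE ih =>
    obtain ⟨σ, v, hv, -, -, hb, rfl⟩ := hE
    rintro a b hba (ha | rfl | rfl)
    · exact Or.inl (ih hba ha)
    · by_cases hb' : b = a
      · exact Or.inr (Or.inl hb')
      · exact Or.inl (hb b (hba.trans (subset_insert _ _)) hb'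
          fun h => hv (hba (h ▸ mem_insert_self _ _)))
    · by_cases h1 : b = σ
      · exact Or.inr (Or.inl h1)
      · by_cases h2 : b = insert v σ
        · exact Or.inr (Or.inr h2)
        · exact Or.inl (hb b hba h1 h2)
  | attach _ _ hb _ ih =>
    rintro a b hba (ha | rfl)
    · exact Or.inl (ih hba ha)
    · rcases eq_or_ssubset_of_subset hba with h | h
      · exact Or.inr h
      · exact Or.inl (hb b h)

/-- A lower set of cells may be enlarged by finitely many cells matched by toggling a vertex. -/
lemma of_toggle (v : V) (hX : IsLowerSet X) (hY : IsLowerSet Y) (hXY : X ⊆ Y)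
    (hfin : (Y \ X).Finite)
    (hins : ∀ σ ∈ Y \ X, insert v σ ∈ Y) (hers : ∀ σ ∈ Y \ X, σ.erase v ∉ X) :
    Built d X 0 Y := by
  induction hn : (Y \ X).ncard using Nat.strong_induction_on generalizing X with
  | _ n ih =>
    subst hn
    rcases (Y \ X).eq_empty_or_nonempty with h0 | hne
    · rw [hXY.antisymm (Set.sdiff_eq_empty.mp h0)]
      exact base
    · obtain ⟨σ, hσ, hmin⟩ := Set.exists_min_image _ Finset.card hfin hne
      have hvσ : v ∉ σ := fun hv => by
        have h1 := hmin (σ.erase v) ⟨hY (erase_subset _ _) hσ.1, hers σ hσ⟩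
        exact absurd h1 (not_le.mpr (card_erase_lt_of_mem hv))
      have hi : insert v σ ∉ X := fun h => hσ.2 (hX (subset_insert _ _) h)
      have hE : ElemExp X (X ∪ {σ, insert v σ}) := by
        refine ⟨σ, v, hvσ, hσ.2, hi, fun ρ hρ h1 h2 => ?_, rfl⟩
        by_contra hρX
        have hρY : ρ ∈ Y \ X := ⟨hY hρ (hins σ hσ), hρX⟩
        have h3 := hmin (ρ.erase v) ⟨hY (erase_subset _ _) hρY.1, hers ρ hρY⟩
        have h4 : ρ.erase v ⊆ σ := by
          intro x hx
          have := hρ (mem_of_mem_erase hx)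
          exact (mem_insert.mp this).resolve_left (ne_of_mem_erase hx)
        have h5 := eq_of_subset_of_card_le h4 h3
        by_cases hvρ : v ∈ ρ
        · exact h2 (by rw [← h5, insert_erase hvρ])
        · exact h1 (by rw [← h5, erase_eq_of_notMem hvρ])
      have hB : Built d X 0 (X ∪ {σ, insert v σ}) := base.expand hE
      have hss : Y \ (X ∪ {σ, insert v σ}) ⊆ Y \ X :=
        Set.sdiff_subset_sdiff_right Set.subset_union_left
      refine hB.trans (ih _ ?_ (hB.isLowerSet hX) ?_ (hfin.subset hss) ?_ ?_ rfl)
      · refine Set.ncard_lt_ncard (hss.ssubset_of_ne fun h => ?_) hfin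
        exact ((h ▸ hσ : σ ∈ Y \ (X ∪ {σ, insert v σ}))).2 (by simp)
      · exact Set.union_subset hXY (by
          rintro _ (rfl | rfl)
          exacts [hσ.1, hins _ hσ])
      · exact fun ρ hρ => hins ρ (hss hρ)
      · rintro ρ hρ (h | h | h)
        · exact hers ρ (hss hρ) h
        · by_cases hvρ : v ∈ ρ
          · exact hρ.2 (by rw [← insert_erase hvρ, h]; simp)
          · exact hρ.2 (by rw [← erase_eq_of_notMem hvρ, h]; simp)
        · exact notMem_erase v ρ (h ▸ mem_insert_self _ _)

/-- Adding several families of cells, each matched by toggling a vertex. -/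
lemma of_toggles {ι : Type} (J : Finset ι) (S : ι → Set (Finset V)) (v : ι → V)
    (hX : IsLowerSet X) (hS : ∀ i ∈ J, IsLowerSet (X ∪ S i)) (hfin : ∀ i ∈ J, (S i).Finite)
    (hdX : ∀ i ∈ J, Disjoint (S i) X) (hd : ∀ i ∈ J, ∀ j ∈ J, i ≠ j → Disjoint (S i) (S j))
    (hins : ∀ i ∈ J, ∀ σ ∈ S i, insert (v i) σ ∈ S i)
    (hers : ∀ i ∈ J, ∀ σ ∈ S i, σ.erase (v i) ∈ S i) :
    Built d X 0 (X ∪ ⋃ i ∈ J, S i) := by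
  classical
  induction J using Finset.induction_on with
  | empty => simpa using base
  | insert i J hi ih =>
    have h1 := ih (fun j hj => hS j (mem_insert_of_mem hj))
      (fun j hj => hfin j (mem_insert_of_mem hj))
      (fun j hj => hdX j (mem_insert_of_mem hj))
      (fun j hj k hk => hd j (mem_insert_of_mem hj) k (mem_insert_of_mem hk))
      (fun j hj => hins j (mem_insert_of_mem hj)) (fun j hj => hers j (mem_insert_of_mem hj))
    have hi' := mem_insert_self i J
    have hdis : ∀ σ ∈ S i, σ ∉ X ∪ ⋃ j ∈ J, S j := by
      rintro σ hσ (h | h)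
      · exact Set.disjoint_left.mp (hdX i hi') hσ h
      · simp only [Set.mem_iUnion] at h
        obtain ⟨j, hj, h⟩ := h
        exact Set.disjoint_left.mp (hd i hi' j (mem_insert_of_mem hj) (by rintro rfl; exact hi hj))
          hσ h
    have hdiff : (X ∪ ⋃ j ∈ insert i J, S j) \ (X ∪ ⋃ j ∈ J, S j) = S i := by
      ext σ
      have := hdis σ
      simp only [Set.mem_sdiff, Set.mem_union, Set.mem_iUnion, mem_insert] at this ⊢
      constructor
      · rintro ⟨h | ⟨j, rfl | hj, h⟩, h2⟩
        · exact absurd (Or.inl h) h2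
        · exact h
        · exact absurd (Or.inr ⟨j, hj, h⟩) h2
      · exact fun h => ⟨Or.inr ⟨i, Or.inl rfl, h⟩, this h⟩
    refine h1.trans (of_toggle (v i) (h1.isLowerSet hX) ?_ ?_ (hdiff ▸ hfin i hi') ?_ ?_)
    · rintro a b hba (h | h)
      · exact Or.inl (hX hba h)
      · simp only [Set.mem_iUnion] at h
        obtain ⟨j, hj, h⟩ := h
        rcases hS j hj hba (Or.inr h) with h | h
        · exact Or.inl h
        · exact Or.inr (Set.mem_biUnion hj h)
    · exact Set.union_subset_union_right _
        (Set.biUnion_subset_biUnion_left fun j hj => mem_insert_of_mem hj)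
    · intro σ hσ
      rw [hdiff] at hσ
      exact Or.inr (Set.mem_biUnion hi' (hins i hi' σ hσ))
    · intro σ hσ
      rw [hdiff] at hσ
      exact hdis _ (hers i hi' σ hσ)

lemma of_attach (T : Finset (Finset V)) (hT : ∀ τ ∈ T, τ ∉ X) (hb : ∀ τ ∈ T, ∀ ρ ⊂ τ, ρ ∈ X)
    (hc : ∀ τ ∈ T, τ.card = d) : Built d X T.card (X ∪ T) := by
  induction T using Finset.induction_on with
  | empty => simpa using base
  | insert τ T hτ ih =>
    have h1 := ih (fun j hj => hT j (mem_insert_of_mem hj))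
      (fun j hj => hb j (mem_insert_of_mem hj))
      (fun j hj => hc j (mem_insert_of_mem hj))
    have hτ' := mem_insert_self τ T
    have h2 := h1.attach (τ := τ) (by simpa using ⟨hT τ hτ', hτ⟩)
      (fun ρ hρ => Or.inl (hb τ hτ' ρ hρ)) (hc τ hτ')
    rw [card_insert_of_notMem hτ]
    convert h2 using 1
    ext; simp

/-- Coning off: a construction of `L` from nothing becomes a construction that adds
the cells containing a new vertex `a` whose links are the cells of `L`. -/
lemma cone {E : Type} [DecidableEq E] {r : ℕ} {L : Set (Finset E)} {K : Set (Finset V)} (φ : E → V)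
    (D : Set E) (hφ : Set.InjOn φ D) (a : V) (haφ : ∀ e ∈ D, φ e ≠ a) (hK : ∀ σ ∈ K, a ∉ σ)
    (h : Built d ∅ r L) (hLD : ∀ σ ∈ L, ↑σ ⊆ D) (hLK : ∀ σ ∈ L, σ.image φ ∈ K) :
    Built (d + 1) K r (K ∪ (fun σ => insert a (σ.image φ)) '' L) := by
  have inj : ∀ σ τ : Finset E, ↑σ ⊆ D → ↑τ ⊆ D →
      insert a (σ.image φ) = insert a (τ.image φ) → σ = τ := by
    intro σ τ hσ hτ h
    have key : ∀ σ : Finset E, ↑σ ⊆ D → (insert a (σ.image φ)).erase a = σ.image φ := by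
      intro σ hσ
      refine erase_insert fun h => ?_
      obtain ⟨e, he, h⟩ := mem_image.mp h
      exact haφ e (hσ he) h
    have h2 : σ.image φ = τ.image φ := by rw [← key σ hσ, ← key τ hτ, h]
    have h3 : φ '' σ = φ '' τ := by rw [← coe_image, ← coe_image, h2]
    exact_mod_cast (hφ.image_eq_image_iff hσ hτ).mp h3
  have notK : ∀ σ : Finset E, insert a (σ.image φ) ∉ K :=
    fun σ h => hK _ h (mem_insert_self _ _)
  have sub : ∀ (τ : Finset E) (ρ : Finset V), ρ ⊆ insert a (τ.image φ) →
      ∃ ρ' ⊆ τ, ρ = ρ'.image φ ∨ ρ = insert a (ρ'.image φ) := by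
    intro τ ρ hρ
    have h1 : ρ.erase a ⊆ τ.image φ := fun x hx =>
      (mem_insert.mp (hρ (mem_of_mem_erase hx))).resolve_left (ne_of_mem_erase hx)
    obtain ⟨ρ', hρ', h2⟩ := subset_image_iff.mp h1
    refine ⟨ρ', mod_cast hρ', ?_⟩
    by_cases ha : a ∈ ρ
    · exact Or.inr (by rw [h2, insert_erase ha])
    · exact Or.inl (by rw [h2, erase_eq_of_notMem ha])
  induction h with
  | base => simpa using Built.base
  | @expand t X Y hB hE ih =>
    have hlow := (hB.expand hE).isLowerSet (isLowerSet_empty)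
    obtain ⟨σ, v, hv, hσ, hi, hb, rfl⟩ := hE
    have hXD : ∀ σ ∈ X, ↑σ ⊆ D := fun σ h => hLD σ (Or.inl h)
    have hiD := hLD (insert v σ) (by simp)
    have hσD := hLD σ (by simp)
    refine (ih hXD fun σ h => hLK σ (Or.inl h)).expand
      ⟨insert a (σ.image φ), φ v, ?_, ?_, ?_, ?_, ?_⟩
    · rw [mem_insert, not_or]
      have hvD : v ∈ D := hiD (by simp)
      refine ⟨haφ v hvD, fun h => ?_⟩
      obtain ⟨e, he, h⟩ := mem_image.mp h
      exact hv (hφ (hσD he) hvD h ▸ he)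
    · rintro (h | ⟨ρ, hρ, h⟩)
      · exact notK _ h
      · exact hσ (inj _ _ (hXD ρ hρ) hσD h ▸ hρ)
    · rw [insert_comm, ← image_insert]
      rintro (h | ⟨ρ, hρ, h⟩)
      · exact notK _ h
      · exact hi (inj _ _ (hXD ρ hρ) hiD h ▸ hρ)
    · rw [insert_comm, ← image_insert]
      intro ρ hρ h1 h2
      obtain ⟨ρ', hρ', rfl | rfl⟩ := sub _ _ hρ
      · exact Or.inl (hLK _ (hlow hρ' (by simp)))
      · exact Or.inr ⟨ρ', hb ρ' hρ' (fun h => h1 (h ▸ rfl)) (fun h => h2 (h ▸ rfl)), rfl⟩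
    · rw [insert_comm, ← image_insert, Set.image_union, Set.image_pair, Set.union_assoc]
  | @attach t X τ hB hτ hb hc ih =>
    have hXD : ∀ σ ∈ X, ↑σ ⊆ D := fun σ h => hLD σ (Or.inl h)
    have hτD := hLD τ (by simp)
    have h2 := (ih hXD fun σ h => hLK σ (Or.inl h)).attach (τ := insert a (τ.image φ)) ?_ ?_ ?_
    · rwa [Set.image_union, Set.image_singleton, ← Set.union_assoc]
    · rintro (h | ⟨ρ, hρ, h⟩)
      · exact notK _ h
      · exact hτ (inj _ _ (hXD ρ hρ) hτD h ▸ hρ)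
    · intro ρ hρ
      obtain ⟨ρ', hρ', rfl | rfl⟩ := sub _ _ hρ.1
      · rcases eq_or_ssubset_of_subset hρ' with rfl | h
        · exact Or.inl (hLK _ (by simp))
        · exact Or.inl (hLK _ (Or.inl (hb _ h)))
      · refine Or.inr ⟨ρ', hb ρ' (hρ'.ssubset_of_ne ?_), rfl⟩
        rintro rfl
        exact hρ.2 subset_rfl
    · rw [card_insert_of_notMem, card_image_of_injOn (hφ.mono hτD), hc]
      intro h
      obtain ⟨e, he, h⟩ := mem_image.mp h
      exact haφ e (hτD he) h

end Built

end Building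

section LineGraph

/-- The edges `{u, v}`, `u < v ∈ A`, of a graph on the natural numbers. -/
def edgesTo (A : Finset ℕ) : Set (Finset ℕ) := {e | ∃ u v, u < v ∧ v ∈ A ∧ e = {u, v}}

/-- The finite families of pairwise intersecting edges `{u, v}`, `u < v ∈ A`: the simplices, the
empty one included, of the clique complex of the line graph. -/
def lineCliques (A : Finset ℕ) : Set (Finset (Finset ℕ)) :=
  {σ | (∀ e ∈ σ, e ∈ edgesTo A) ∧ ∀ e ∈ σ, ∀ f ∈ σ, ¬ Disjoint e f}

/-- The set of edges of the triangle `x y z`. -/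
def triangle (x y z : ℕ) : Finset (Finset ℕ) := {{x, y}, {x, z}, {y, z}}

/-- The triangles `y < x < x'` with `x` and `x'` in `B`, as sets of edges. -/
def trianglesTo (B : Finset ℕ) : Finset (Finset (Finset ℕ)) :=
  (B.sigma fun x => range x ×ˢ B.filter (x < ·)).image fun p => triangle p.2.1 p.1 p.2.2

lemma mem_trianglesTo {B : Finset ℕ} {τ : Finset (Finset ℕ)} :
    τ ∈ trianglesTo B ↔ ∃ y x z, y < x ∧ x < z ∧ x ∈ B ∧ z ∈ B ∧ triangle y x z = τ := by
  simp only [trianglesTo, mem_image, mem_sigma, mem_product, mem_range, mem_filter]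
  constructor
  · rintro ⟨⟨x, y, z⟩, ⟨hx, hy, hz, hxz⟩, rfl⟩
    exact ⟨y, x, z, hy, hxz, hx, hz, rfl⟩
  · rintro ⟨y, x, z, hy, hxz, hx, hz, rfl⟩
    exact ⟨⟨x, y, z⟩, ⟨hx, hy, hz, hxz⟩, rfl⟩

lemma biUnion_triangle (x y z : ℕ) : (triangle x y z).biUnion id = {x, y, z} := by
  ext; simp [triangle]

lemma pair_inj_of_lt {u v p q : ℕ} (h : u < v) (h' : p < q) (he : ({u, v} : Finset ℕ) = {p, q}) :
    u = p ∧ v = q := by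
  have h1 : u ∈ ({p, q} : Finset ℕ) := he ▸ by simp
  have h2 : v ∈ ({p, q} : Finset ℕ) := he ▸ by simp
  simp at h1 h2
  omega

lemma card_trianglesTo (B : Finset ℕ) :
    (trianglesTo B).card = ∑ x ∈ B, x * (B.filter (x < ·)).card := by
  rw [trianglesTo, card_image_of_injOn, card_sigma]
  · simp
  · rintro ⟨x, y, z⟩ h ⟨x', y', z'⟩ h' he
    simp only [coe_sigma, Set.mem_sigma_iff, coe_product, Set.mem_prod, mem_coe, mem_range,
      mem_filter] at h h'
    have he := congrArg (fun σ => σ.biUnion id) he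
    simp only [biUnion_triangle] at he
    have h1 : x ∈ ({y', x', z'} : Finset ℕ) := he ▸ by simp
    have h2 : y ∈ ({y', x', z'} : Finset ℕ) := he ▸ by simp
    have h3 : z ∈ ({y', x', z'} : Finset ℕ) := he ▸ by simp
    have h4 : x' ∈ ({y, x, z} : Finset ℕ) := he ▸ by simp
    simp at h1 h2 h3 h4
    obtain rfl : x = x' := by omega
    obtain rfl : y = y' := by omega
    obtain rfl : z = z' := by omega
    rfl

lemma card_triangle {x y z : ℕ} (h1 : x < y) (h2 : y < z) : (triangle x y z).card = 3 := by
  rw [triangle, card_eq_three]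
  refine ⟨_, _, _, ?_, ?_, ?_, rfl⟩
  · intro h; have := pair_inj_of_lt h1 (h1.trans h2) h; omega
  · intro h; have := pair_inj_of_lt h1 h2 h; omega
  · intro h; have := pair_inj_of_lt (h1.trans h2) h2 h; omega

lemma edgesTo_eq_pair {A e : Finset ℕ} (he : e ∈ edgesTo A) {x y : ℕ} (hx : x ∈ e) (hy : y ∈ e)
    (hxy : x ≠ y) : e = {x, y} := by
  obtain ⟨u, v, huv, -, rfl⟩ := he
  simp at hx hy
  ext; simp; omega

lemma pair_mem_edgesTo {A : Finset ℕ} {u v : ℕ} (huv : u < v) :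
    ({u, v} : Finset ℕ) ∈ edgesTo A ↔ v ∈ A := by
  constructor
  · rintro ⟨u', v', h, hv, he⟩
    rwa [(pair_inj_of_lt huv h he).2]
  · exact fun h => ⟨u, v, huv, h, rfl⟩

lemma triangle_perm₁ (x y z : ℕ) : triangle x y z = triangle y x z := by
  ext; simp [triangle, pair_comm x y]; tauto

lemma triangle_perm₂ (x y z : ℕ) : triangle x y z = triangle x z y := by
  ext; simp [triangle, pair_comm y z]; tauto

lemma lineCliques_triangle_mem {A : Finset ℕ} {x y z : ℕ} (hxy : x ≠ y) (hxz : x ≠ z) (hyz : y ≠ z)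
    {a : ℕ} (hx : x ≠ a) (hy : y ≠ a) (hz : z ≠ a) (h1 : {x, y} ∈ edgesTo A)
    (h2 : {x, z} ∈ edgesTo A) (h3 : {y, z} ∈ edgesTo A) :
    triangle x y z ∈ trianglesTo (A.erase a) := by
  have key : ∀ x y z, x < y → y < z → y ≠ a → z ≠ a → ({x, y} : Finset ℕ) ∈ edgesTo A →
      ({y, z} : Finset ℕ) ∈ edgesTo A → triangle x y z ∈ trianglesTo (A.erase a) :=
    fun x y z h1 h2 hy hz h3 h4 => mem_trianglesTo.mpr ⟨x, y, z, h1, h2,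
      mem_erase.mpr ⟨hy, (pair_mem_edgesTo h1).mp h3⟩,
      mem_erase.mpr ⟨hz, (pair_mem_edgesTo h2).mp h4⟩, rfl⟩
  rcases lt_or_gt_of_ne hxy with h | h <;> rcases lt_or_gt_of_ne hxz with h' | h' <;>
    rcases lt_or_gt_of_ne hyz with h'' | h''
  · exact key _ _ _ h h'' hy hz h1 h3
  · rw [triangle_perm₂]
    exact key _ _ _ h' h'' hz hy h2 (pair_comm y z ▸ h3)
  · omega
  · rw [triangle_perm₂, triangle_perm₁]
    exact key _ _ _ h' h hx hy (pair_comm x z ▸ h2) h1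
  · rw [triangle_perm₁]
    exact key _ _ _ h h' hx hz (pair_comm x y ▸ h1) h2
  · omega
  · rw [triangle_perm₁, triangle_perm₂]
    exact key _ _ _ h'' h' hz hx h3 (pair_comm x z ▸ h2)
  · rw [triangle_perm₁, triangle_perm₂, triangle_perm₁]
    exact key _ _ _ h'' h hy hx (pair_comm y z ▸ h3) (pair_comm x y ▸ h1)

/-- Either a family of pairwise intersecting edges has two distinct edges avoiding `a`, and then it
is a star or a triangle avoiding `a`, or it has at most one such edge. -/
lemma lineCliques_cases {A : Finset ℕ} {σ : Finset (Finset ℕ)} (hσ : σ ∈ lineCliques A)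
    {a : ℕ} {e f : Finset ℕ} (he : e ∈ σ) (hf : f ∈ σ) (hef : e ≠ f) (hae : a ∉ e) (haf : a ∉ f) :
    (∃ v ∈ e, ∀ g ∈ σ, v ∈ g) ∨ σ ∈ trianglesTo (A.erase a) := by
  obtain ⟨v, hve, hvf⟩ := not_disjoint_iff.mp (hσ.2 e he f hf)
  by_cases h : ∀ g ∈ σ, v ∈ g
  · exact Or.inl ⟨v, hve, h⟩
  push Not at h
  obtain ⟨g, hg, hvg⟩ := h
  obtain ⟨p, hpe, hpg⟩ := not_disjoint_iff.mp (hσ.2 e he g hg)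
  obtain ⟨q, hqf, hqg⟩ := not_disjoint_iff.mp (hσ.2 f hf g hg)
  have hvp : v ≠ p := by rintro rfl; exact hvg hpg
  have hvq : v ≠ q := by rintro rfl; exact hvg hqg
  have h1 := edgesTo_eq_pair (hσ.1 e he) hve hpe hvp
  have h2 := edgesTo_eq_pair (hσ.1 f hf) hvf hqf hvq
  have hpq : p ≠ q := by rintro rfl; exact hef (h1.trans h2.symm)
  have h3 := edgesTo_eq_pair (hσ.1 g hg) hpg hqg hpq
  have hσ' : σ = triangle v p q := by
    ext k
    simp only [triangle, mem_insert, mem_singleton, ← h1, ← h2, ← h3]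
    constructor
    · intro hk
      obtain ⟨x, hxk, hx⟩ := not_disjoint_iff.mp (hσ.2 k hk e he)
      obtain ⟨y, hyk, hy⟩ := not_disjoint_iff.mp (hσ.2 k hk f hf)
      obtain ⟨z, hzk, hz⟩ := not_disjoint_iff.mp (hσ.2 k hk g hg)
      rw [h1, mem_insert, mem_singleton] at hx
      rw [h2, mem_insert, mem_singleton] at hy
      rw [h3, mem_insert, mem_singleton] at hz
      by_cases hvk : v ∈ k
      · rcases hz with rfl | rfl
        · exact Or.inl ((edgesTo_eq_pair (hσ.1 k hk) hvk hzk hvp).trans h1.symm)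
        · exact Or.inr (Or.inl ((edgesTo_eq_pair (hσ.1 k hk) hvk hzk hvq).trans h2.symm))
      · obtain rfl : x = p := hx.resolve_left (by rintro rfl; exact hvk hxk)
        obtain rfl : y = q := hy.resolve_left (by rintro rfl; exact hvk hyk)
        exact Or.inr (Or.inr ((edgesTo_eq_pair (hσ.1 k hk) hxk hyk hpq).trans h3.symm))
    · rintro (rfl | rfl | rfl) <;> assumption
  refine Or.inr (hσ' ▸ ?_)
  have hav : v ≠ a := by rintro rfl; exact hae hve
  have hap : p ≠ a := by rintro rfl; exact hae hpe
  have haq : q ≠ a := by rintro rfl; exact haf hqf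
  exact lineCliques_triangle_mem hvp hvq hpq hav hap haq (h1 ▸ hσ.1 e he) (h2 ▸ hσ.1 f hf)
    (h3 ▸ hσ.1 g hg)

lemma isLowerSet_lineCliques (A : Finset ℕ) : IsLowerSet (lineCliques A) :=
  fun _ _ h hσ => ⟨fun e he => hσ.1 e (h he), fun e he f hf => hσ.2 e (h he) f (h hf)⟩

lemma finite_lineCliques (A : Finset ℕ) : (lineCliques A).Finite := by
  refine ((range (A.sup id + 1)).powerset.powerset.finite_toSet).subset fun σ hσ => ?_
  rw [mem_coe, mem_powerset]
  intro e he
  obtain ⟨u, v, huv, hv, rfl⟩ := hσ.1 e he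
  have : v ≤ A.sup id := le_sup (f := id) hv
  rw [mem_powerset]
  intro x hx
  simp at hx ⊢
  omega

/-- The clique complex of the line graph is built from a point by expansions and by attaching one
`2`-cell for every triangle avoiding the largest element of `A`. -/
lemma built_lineCliques {A : Finset ℕ} {a : ℕ} (ha : a ∈ A) (hmax : ∀ x ∈ A, x ≤ a) (h0 : 0 < a) :
    Built 3 ∅ (trianglesTo (A.erase a)).card (lineCliques A) := by
  classical
  have hle : ∀ e ∈ edgesTo A, ∀ x ∈ e, x ≤ a := by
    rintro _ ⟨u, v, huv, hv, rfl⟩ x hx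
    have := hmax v hv
    simp at hx; omega
  have haE : ∀ u < a, ({u, a} : Finset ℕ) ∈ edgesTo A := fun u hu => ⟨u, a, hu, ha, rfl⟩
  -- the star of `a`
  set X₁ : Set (Finset (Finset ℕ)) := {σ | ∀ e ∈ σ, e ∈ edgesTo A ∧ a ∈ e} with hX₁
  have hX₁L : X₁ ⊆ lineCliques A := fun σ hσ => ⟨fun e he => (hσ e he).1, fun e he f hf =>
    not_disjoint_iff.mpr ⟨a, (hσ e he).2, (hσ f hf).2⟩⟩
  have low₁ : IsLowerSet X₁ := fun σ ρ h hσ e he => hσ e (h he)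
  have B₁ : Built 3 ∅ 0 X₁ := by
    refine Built.of_toggle {0, a} isLowerSet_empty low₁ (Set.empty_subset _)
      ((finite_lineCliques A).subset (Set.sdiff_subset.trans hX₁L)) ?_ (fun _ _ h => h)
    rintro σ ⟨hσ, -⟩ e he
    rcases mem_insert.mp he with rfl | he
    · exact ⟨haE 0 h0, by simp⟩
    · exact hσ e he
  -- one edge avoiding `a`
  set J : Finset (ℕ × ℕ) := (range a ×ˢ range a).filter fun p => p.1 < p.2 ∧ p.2 ∈ A with hJ
  set S : ℕ × ℕ → Set (Finset (Finset ℕ)) := fun p =>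
    {σ | {p.1, p.2} ∈ σ ∧ ∀ e ∈ σ, e = {p.1, p.2} ∨ e = {p.1, a} ∨ e = {p.2, a}} with hS
  have memJ : ∀ p ∈ J, p.1 < a ∧ p.2 < a ∧ p.1 < p.2 ∧ p.2 ∈ A := by
    intro p hp
    simp only [hJ, mem_filter, mem_product, mem_range] at hp
    tauto
  have naJ : ∀ p ∈ J, a ∉ ({p.1, p.2} : Finset ℕ) := by
    intro p hp
    have := memJ p hp
    simp; omega
  have hSL : ∀ p ∈ J, S p ⊆ lineCliques A := by
    intro p hp σ hσ
    obtain ⟨h1, h2, h3, h4⟩ := memJ p hp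
    constructor
    · intro e he
      rcases hσ.2 e he with rfl | rfl | rfl
      · exact ⟨_, _, h3, h4, rfl⟩
      · exact haE _ h1
      · exact haE _ h2
    · intro e he f hf
      rcases hσ.2 e he with rfl | rfl | rfl <;> rcases hσ.2 f hf with rfl | rfl | rfl <;> simp
  have B₂ : Built 3 X₁ 0 (X₁ ∪ ⋃ p ∈ J, S p) := by
    refine Built.of_toggles J S (fun p => {p.2, a}) low₁ ?_
      (fun p hp => (finite_lineCliques A).subset (hSL p hp)) ?_ ?_ ?_ ?_
    · rintro p hp σ ρ h (hσ | hσ)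
      · exact Or.inl (low₁ h hσ)
      · by_cases hpρ : {p.1, p.2} ∈ ρ
        · exact Or.inr ⟨hpρ, fun e he => hσ.2 e (h he)⟩
        · refine Or.inl fun e he => ⟨(hSL p hp hσ).1 e (h he), ?_⟩
          rcases hσ.2 e (h he) with rfl | rfl | rfl
          · exact absurd he hpρ
          · simp
          · simp
    · refine fun p hp => Set.disjoint_left.mpr fun σ hσ h => ?_
      exact naJ p hp (h _ hσ.1).2
    · refine fun p hp q hq hpq => Set.disjoint_left.mpr fun σ hσ h => hpq ?_
      obtain ⟨-, -, h3, -⟩ := memJ p hp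
      obtain ⟨-, -, h3', -⟩ := memJ q hq
      rcases h.2 _ hσ.1 with h | h | h
      · exact Prod.ext_iff.mpr (pair_inj_of_lt h3 h3' h)
      · exact absurd (h ▸ by simp) (naJ p hp)
      · exact absurd (h ▸ by simp) (naJ p hp)
    · intro p hp σ hσ
      refine ⟨mem_insert_of_mem hσ.1, fun e he => ?_⟩
      rcases mem_insert.mp he with rfl | he
      · exact Or.inr (Or.inr rfl)
      · exact hσ.2 e he
    · intro p hp σ hσ
      refine ⟨mem_erase.mpr ⟨fun h => naJ p hp (h ▸ by simp), hσ.1⟩, fun e he =>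
        hσ.2 e (mem_of_mem_erase he)⟩
  -- at least two edges avoiding `a`, with a common vertex
  set X₂ := X₁ ∪ ⋃ p ∈ J, S p with hX₂
  have low₂ : IsLowerSet X₂ := B₂.isLowerSet low₁
  set S' : ℕ → Set (Finset (Finset ℕ)) := fun v =>
    {σ | (∀ e ∈ σ, e ∈ edgesTo A ∧ v ∈ e) ∧ ∃ e ∈ σ, ∃ f ∈ σ, e ≠ f ∧ a ∉ e ∧ a ∉ f} with hS'
  have hS'L : ∀ v, S' v ⊆ lineCliques A := fun v σ hσ => ⟨fun e he => (hσ.1 e he).1,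
    fun e he f hf => not_disjoint_iff.mpr ⟨v, (hσ.1 e he).2, (hσ.1 f hf).2⟩⟩
  have hX₂L : X₂ ⊆ lineCliques A := Set.union_subset hX₁L (Set.iUnion₂_subset hSL)
  have hX₂u : ∀ σ ∈ X₂, ∀ e ∈ σ, ∀ f ∈ σ, a ∉ e → a ∉ f → e = f := by
    rintro σ (hσ | hσ) e he f hf hae haf
    · exact absurd (hσ e he).2 hae
    · simp only [Set.mem_iUnion] at hσ
      obtain ⟨p, -, hσ⟩ := hσ
      have key : ∀ e ∈ σ, a ∉ e → e = {p.1, p.2} := by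
        intro e he hae
        rcases hσ.2 e he with h | h | h
        · exact h
        · exact absurd (h ▸ by simp) hae
        · exact absurd (h ▸ by simp) hae
      rw [key e he hae, key f hf haf]
  have cover₂ : ∀ σ ∈ lineCliques A, (∀ e ∈ σ, ∀ f ∈ σ, a ∉ e → a ∉ f → e = f) → σ ∈ X₂ := by
    intro σ hσ hu
    by_cases h : ∀ e ∈ σ, a ∈ e
    · exact Or.inl fun e he => ⟨hσ.1 e he, h e he⟩
    push Not at h
    obtain ⟨e, he, hae⟩ := h
    obtain ⟨u, v, huv, hv, rfl⟩ := hσ.1 e he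
    have hva : v < a := lt_of_le_of_ne (hmax v hv) (by rintro rfl; simp at hae)
    refine Or.inr (Set.mem_biUnion (x := (u, v)) ?_ ⟨he, fun f hf => ?_⟩)
    · simp only [hJ, mem_coe, mem_filter, mem_product, mem_range]
      exact ⟨⟨huv.trans hva, hva⟩, huv, hv⟩
    · by_cases haf : a ∈ f
      · obtain ⟨x, hx, hxf⟩ := not_disjoint_iff.mp (hσ.2 _ he f hf)
        have hxa : x ≠ a := by rintro rfl; exact hae hx
        have := edgesTo_eq_pair (hσ.1 f hf) hxf haf hxa
        rw [mem_insert, mem_singleton] at hx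
        rcases hx with rfl | rfl
        · exact Or.inr (Or.inl this)
        · exact Or.inr (Or.inr this)
      · exact Or.inl (hu f hf _ he haf hae)
  have B₃ : Built 3 X₂ 0 (X₂ ∪ ⋃ v ∈ range a, S' v) := by
    refine Built.of_toggles (range a) S' (fun v => {v, a}) low₂ ?_
      (fun v _ => (finite_lineCliques A).subset (hS'L v)) ?_ ?_ ?_ ?_
    · rintro v - σ ρ h (hσ | hσ)
      · exact Or.inl (low₂ h hσ)
      · by_cases hρ : ∃ e ∈ ρ, ∃ f ∈ ρ, e ≠ f ∧ a ∉ e ∧ a ∉ f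
        · exact Or.inr ⟨fun e he => hσ.1 e (h he), hρ⟩
        · push Not at hρ
          refine Or.inl (cover₂ ρ (isLowerSet_lineCliques A h (hS'L v hσ)) ?_)
          intro e he f hf hae haf
          by_contra hef
          exact haf (hρ e he f hf hef hae)
    · rintro v - 
      refine Set.disjoint_left.mpr fun σ hσ h => ?_
      obtain ⟨-, e, he, f, hf, hef, hae, haf⟩ := hσ
      exact hef (hX₂u σ h e he f hf hae haf)
    · rintro v - w - hvw
      refine Set.disjoint_left.mpr fun σ hσ h => ?_
      obtain ⟨hv, e, he, f, hf, hef, hae, haf⟩ := hσ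
      exact hef ((edgesTo_eq_pair (hv e he).1 (hv e he).2 (h.1 e he).2 hvw).trans
        (edgesTo_eq_pair (hv f hf).1 (hv f hf).2 (h.1 f hf).2 hvw).symm)
    · rintro v hv σ ⟨h1, e, he, f, hf, h⟩
      refine ⟨fun g hg => ?_, e, mem_insert_of_mem he, f, mem_insert_of_mem hf, h⟩
      rcases mem_insert.mp hg with rfl | hg
      · exact ⟨haE v (mem_range.mp hv), by simp⟩
      · exact h1 g hg
    · rintro v hv σ ⟨h1, e, he, f, hf, hef, hae, haf⟩
      refine ⟨fun g hg => h1 g (mem_of_mem_erase hg), e, mem_erase.mpr ⟨?_, he⟩, f,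
        mem_erase.mpr ⟨?_, hf⟩, hef, hae, haf⟩
      · rintro rfl; simp at hae
      · rintro rfl; simp at haf
  set X₃ := X₂ ∪ ⋃ v ∈ range a, S' v with hX₃
  have hX₃L : X₃ ⊆ lineCliques A := Set.union_subset hX₂L (Set.iUnion₂_subset fun v _ => hS'L v)
  have hT : ∀ y x z, y < x → x < z → x ∈ A.erase a → z ∈ A.erase a →
      triangle y x z ∈ lineCliques A ∧ triangle y x z ∉ X₃ ∧ a ∉ ({y, x, z} : Finset ℕ) := by
    intro y x z hyx hxz hx hz
    have hna : a ∉ ({y, x, z} : Finset ℕ) := by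
      have := hmax x (mem_of_mem_erase hx)
      have := ne_of_mem_erase hx
      have := ne_of_mem_erase hz
      simp; omega
    refine ⟨⟨?_, ?_⟩, ?_, hna⟩
    · intro e he
      simp only [triangle, mem_insert, mem_singleton] at he
      rcases he with rfl | rfl | rfl
      · exact ⟨_, _, hyx, mem_of_mem_erase hx, rfl⟩
      · exact ⟨_, _, hyx.trans hxz, mem_of_mem_erase hz, rfl⟩
      · exact ⟨_, _, hxz, mem_of_mem_erase hz, rfl⟩
    · intro e he f hf
      simp only [triangle, mem_insert, mem_singleton] at he hf
      rcases he with rfl | rfl | rfl <;> rcases hf with rfl | rfl | rfl <;> simp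
    · simp only [mem_insert, mem_singleton, not_or] at hna
      rintro (h | h)
      · have := hX₂u _ h {y, x} (by simp [triangle]) {y, z} (by simp [triangle]) (by simp; omega)
          (by simp; omega)
        have := pair_inj_of_lt hyx (hyx.trans hxz) this
        omega
      · simp only [Set.mem_iUnion] at h
        obtain ⟨v, -, h, -⟩ := h
        have h1 := (h {y, x} (by simp [triangle])).2
        have h2 := (h {y, z} (by simp [triangle])).2
        have h3 := (h {x, z} (by simp [triangle])).2
        simp at h1 h2 h3
        omega
  have cover₃ : ∀ σ ∈ lineCliques A, σ ∉ X₃ → σ ∈ trianglesTo (A.erase a) := by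
    intro σ hσ h3
    by_cases hu : ∀ e ∈ σ, ∀ f ∈ σ, a ∉ e → a ∉ f → e = f
    · exact absurd (Or.inl (cover₂ σ hσ hu)) h3
    push Not at hu
    obtain ⟨e, he, f, hf, hae, haf, hef⟩ := hu
    rcases lineCliques_cases hσ he hf hef hae haf with ⟨v, hve, hv⟩ | h
    · have hσv : σ ∈ S' v := ⟨fun g hg => ⟨hσ.1 g hg, hv g hg⟩, e, he, f, hf, hef, hae, haf⟩
      refine absurd (Or.inr (Set.mem_biUnion (x := v) ?_ hσv)) h3
      exact mem_range.mpr (lt_of_le_of_ne (hle e (hσ.1 e he) v hve) (by rintro rfl; exact hae hve))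
    · exact h
  have B₄ : Built 3 X₃ (trianglesTo (A.erase a)).card (X₃ ∪ trianglesTo (A.erase a)) := by
    refine Built.of_attach _ ?_ ?_ ?_
    · intro τ hτ
      obtain ⟨y, x, z, h1, h2, h3, h4, rfl⟩ := mem_trianglesTo.mp hτ
      exact (hT y x z h1 h2 h3 h4).2.1
    · intro τ hτ ρ hρ
      obtain ⟨y, x, z, h1, h2, h3, h4, rfl⟩ := mem_trianglesTo.mp hτ
      by_contra hρ3
      have hρT := cover₃ ρ (isLowerSet_lineCliques A hρ.1 (hT y x z h1 h2 h3 h4).1) hρ3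
      obtain ⟨y', x', z', h1', h2', -, -, rfl⟩ := mem_trianglesTo.mp hρT
      have := card_lt_card hρ
      rw [card_triangle h1 h2, card_triangle h1' h2'] at this
      exact lt_irrefl _ this
    · intro τ hτ
      obtain ⟨y, x, z, h1, h2, h3, h4, rfl⟩ := mem_trianglesTo.mp hτ
      exact card_triangle h1 h2
  have hL : X₃ ∪ trianglesTo (A.erase a) = lineCliques A := by
    refine Set.Subset.antisymm (Set.union_subset hX₃L ?_) fun σ hσ => ?_
    · intro τ hτ
      obtain ⟨y, x, z, h1, h2, h3, h4, rfl⟩ := mem_trianglesTo.mp (mem_coe.mp hτ)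
      exact (hT y x z h1 h2 h3 h4).1
    · by_cases h : σ ∈ X₃
      · exact Or.inl h
      · exact Or.inr (cover₃ σ hσ h)
  have := ((B₁.trans B₂).trans B₃).trans B₄
  rwa [hL, zero_add, zero_add, zero_add] at this

end LineGraph

section Counting

lemma sum_mul_sub_eq_sum_choose (N : ℕ) :
    ∑ i ∈ range N, (i : ℤ) * (N - i) = ∑ k ∈ Icc 2 N, (k.choose 2 : ℤ) := by
  induction N with
  | zero => simp
  | succ N ih =>
    have h1 : ∑ k ∈ Icc 2 (N + 1), (k.choose 2 : ℤ) =
        ∑ k ∈ Icc 2 N, (k.choose 2 : ℤ) + ((N + 1).choose 2 : ℤ) := by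
      rcases Nat.eq_zero_or_pos N with rfl | h
      · simp
      · rw [sum_Icc_succ_top (by omega)]
    have h2 : (((N + 1).choose 2 : ℕ) : ℤ) = ∑ i ∈ range (N + 1), (i : ℤ) := by
      rw [Nat.choose_two_right, ← sum_range_id]; push_cast; rfl
    rw [h1, h2, ← ih, sum_range_succ, sum_range_succ _ N]
    have h3 : ∀ i ∈ range N, (i : ℤ) * ((N + 1 : ℕ) - i) = i * (N - i) + i := by
      intro i _; push_cast; ring
    rw [sum_congr rfl h3, sum_add_distrib]
    push_cast; ring

/-- Summation by parts for the gaps of an increasing sequence. -/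
lemma sum_gap_mul_choose (g : ℕ → ℤ) (N M : ℕ) (hM : M + 1 ≤ N) :
    ∑ i ∈ range (M + 1), (g i - if i = 0 then 0 else g (i - 1) + 1) * ((N + 1 - i).choose 2 : ℕ) =
      ∑ i ∈ range (M + 1), (g i - i) * (N - i) + (g M - M) * ((N - M).choose 2 : ℕ) := by
  have pascal : ∀ k : ℕ, (((k + 1).choose 2 : ℕ) : ℤ) = k + (k.choose 2 : ℕ) := by
    intro k; rw [Nat.choose_succ_succ' k 1]; simp
  induction M with
  | zero => simp [pascal N]; ring
  | succ M ih =>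
    rw [sum_range_succ, ih (by omega), sum_range_succ _ (M + 1)]
    obtain ⟨k, rfl⟩ := Nat.exists_eq_add_of_le hM
    have e1 : M + 1 + 1 + k + 1 - (M + 1) = k + 1 + 1 := by omega
    have e2 : M + 1 + 1 + k - M = k + 1 + 1 := by omega
    have e3 : M + 1 + 1 + k - (M + 1) = k + 1 := by omega
    rw [e1, e2, e3, pascal (k + 1)]
    simp
    ring

/-- The increasing enumeration of a finite set of natural numbers. -/
lemma exists_enum (A : Finset ℕ) : ∃ g : ℕ → ℕ, (∀ j, (A.sort (· ≤ ·)).getD j 0 = g j) ∧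
    (∀ i j, i < j → j < A.card → g i < g j) ∧ A = (range A.card).image g := by
  refine ⟨fun j => (A.sort (· ≤ ·)).getD j 0, fun _ => rfl, ?_, ?_⟩
  · intro i j hij hj
    have hl : (A.sort (· ≤ ·)).length = A.card := length_sort _
    beta_reduce
    rw [List.getD_eq_getElem _ _ (by omega), List.getD_eq_getElem _ _ (by omega)]
    exact (A.sortedLT_sort).strictMono_get (a := ⟨i, by omega⟩) (b := ⟨j, by omega⟩) hij
  · have hl : (A.sort (· ≤ ·)).length = A.card := length_sort _
    ext x
    rw [← mem_sort (· ≤ ·), List.mem_iff_getElem]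
    simp only [mem_image, mem_range]
    constructor
    · rintro ⟨i, hi, rfl⟩
      exact ⟨i, by omega, by rw [List.getD_eq_getElem _ _ hi]⟩
    · rintro ⟨i, hi, rfl⟩
      exact ⟨i, by omega, by rw [List.getD_eq_getElem _ _ (by omega)]⟩

lemma rA_eq_sum_enum (A : Finset ℕ) (g : ℕ → ℕ) (hg : ∀ j, (A.sort (· ≤ ·)).getD j 0 = g j)
    (hmono : ∀ i j, i < j → j < A.card → g i < g j) :
    rA A = ∑ j ∈ range (A.card - 2), g j * (A.card - 2 - j) := by
  unfold rA
  simp only [hg]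
  rcases Nat.lt_or_ge A.card 3 with h | h
  · have : A.card - 2 = 0 := by omega
    simp [this]
  obtain ⟨M, hM⟩ := Nat.exists_eq_add_of_le' h
  rw [hM]
  have e : M + 3 - 2 = M + 1 := by omega
  rw [e, ← Int.natCast_inj]
  simp only [Nat.cast_add, Nat.cast_sum, Nat.cast_mul]
  rw [← sum_mul_sub_eq_sum_choose]
  have h1 : ∑ ℓ ∈ Icc 1 (M + 1), (((g (ℓ - 1) - if ℓ = 1 then 0 else g (ℓ - 2) + 1 : ℕ) : ℤ)) *
      ((M + 3 - ℓ).choose 2 : ℕ) = ∑ i ∈ range (M + 1),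
        ((g i : ℤ) - if i = 0 then 0 else (g (i - 1) : ℤ) + 1) *
          ((M + 1 + 1 - i).choose 2 : ℕ) := by
    rw [← Ico_add_one_right_eq_Icc, sum_Ico_eq_sum_range]
    refine sum_congr (by simp) fun i hi => ?_
    rw [mem_range] at hi
    have e1 : 1 + i - 1 = i := by omega
    have e2 : 1 + i - 2 = i - 1 := by omega
    have e3 : M + 3 - (1 + i) = M + 1 + 1 - i := by omega
    rw [e1, e2, e3]
    congr 1
    rcases Nat.eq_zero_or_pos i with rfl | h0
    · simp
    · have := hmono (i - 1) i (by omega) (by omega)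
      rw [if_neg (by omega), if_neg (by omega), Nat.cast_sub (by omega)]
      push_cast; ring
  rw [h1, sum_gap_mul_choose (fun i => (g i : ℤ)) (M + 1) M le_rfl]
  have e4 : M + 1 - M = 1 := by omega
  rw [e4, Nat.choose_eq_zero_of_lt (by omega : 1 < 2), Nat.cast_zero, mul_zero, add_zero,
    ← sum_add_distrib]
  refine sum_congr rfl fun i hi => ?_
  rw [mem_range] at hi
  rw [Nat.cast_sub (by omega)]
  push_cast; ring

lemma rA_eq_card_trianglesTo {A : Finset ℕ} {a : ℕ} (ha : a ∈ A) (hmax : ∀ x ∈ A, x ≤ a) :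
    rA A = (trianglesTo (A.erase a)).card := by
  obtain ⟨g, hg, hmono, himg⟩ := exists_enum A
  rw [rA_eq_sum_enum A g hg hmono, card_trianglesTo]
  have hpos : 0 < A.card := card_pos.mpr ⟨a, ha⟩
  set n := A.card with hn
  have hinj : ∀ i < n, ∀ j < n, g i = g j → i = j := by
    intro i hi j hj h
    rcases lt_trichotomy i j with h' | h' | h'
    · exact absurd h (hmono i j h' hj).ne
    · exact h'
    · exact absurd h (hmono j i h' hi).ne'
  have hlt : ∀ i < n, ∀ j < n, (g i < g j ↔ i < j) := by
    intro i hi j hj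
    refine ⟨fun h => ?_, fun h => hmono i j h hj⟩
    by_contra h'
    rcases (not_lt.mp h').eq_or_lt with rfl | h'
    · exact lt_irrefl _ h
    · exact lt_asymm h (hmono j i h' hi)
  have hga : g (n - 1) = a := by
    have h1 : a ∈ (range n).image g := himg ▸ ha
    obtain ⟨j, hj, rfl⟩ := mem_image.mp h1
    rw [mem_range] at hj
    have h2 : g (n - 1) ∈ A := by
      rw [himg]; exact mem_image_of_mem _ (mem_range.mpr (by omega))
    by_contra hne
    have h3 : ¬ j < n - 1 := fun h => (hmono j (n - 1) h (by omega)).not_ge (hmax _ h2)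
    have : j = n - 1 := by omega
    exact hne (by rw [this])
  have herase : A.erase a = (range (n - 1)).image g := by
    ext x
    rw [mem_erase, himg]
    simp only [mem_image, mem_range]
    constructor
    · rintro ⟨hx, j, hj, rfl⟩
      refine ⟨j, ?_, rfl⟩
      by_contra h
      have : j = n - 1 := by omega
      exact hx (by rw [this, hga])
    · rintro ⟨j, hj, rfl⟩
      refine ⟨fun h => ?_, j, by omega, rfl⟩
      rw [← hga] at h
      have := hinj _ (by omega) _ (by omega) h
      omega
  rw [herase, sum_image (fun i hi j hj h =>
    hinj i (by simp at hi; omega) j (by simp at hj; omega) h)]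
  have hcard : ∀ j < n - 1, (((range (n - 1)).image g).filter (g j < ·)).card = n - 2 - j := by
    intro j hj
    have : ((range (n - 1)).image g).filter (g j < ·) = (Ioo j (n - 1)).image g := by
      ext x
      simp only [mem_filter, mem_image, mem_range, mem_Ioo]
      constructor
      · rintro ⟨⟨i, hi, rfl⟩, h⟩
        exact ⟨i, ⟨(hlt j (by omega) i (by omega)).mp h, hi⟩, rfl⟩
      · rintro ⟨i, ⟨h, hi⟩, rfl⟩
        exact ⟨⟨i, hi, rfl⟩, (hlt j (by omega) i (by omega)).mpr h⟩
    rw [this, card_image_of_injOn, Nat.card_Ioo]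
    · omega
    · intro i hi j hj h
      simp at hi hj
      exact hinj i (by omega) j (by omega) h
  have hsum : ∑ j ∈ range (n - 1), g j * (((range (n - 1)).image g).filter (g j < ·)).card =
      ∑ j ∈ range (n - 1), g j * (n - 2 - j) :=
    sum_congr rfl fun j hj => by rw [hcard j (mem_range.mp hj)]
  rw [hsum]
  rcases Nat.lt_or_ge n 2 with h | h
  · have : n = 1 := by omega
    simp [this]
  · obtain ⟨k, hk⟩ := Nat.exists_eq_add_of_le' h
    rw [hk]
    have e1 : k + 2 - 2 = k := by omega
    have e2 : k + 2 - 1 = k + 1 := by omega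
    rw [e1, e2, sum_range_succ]
    simp

end Counting

section VietorisRips

/-- The simplices of the Vietoris–Rips complex at scale `2`, together with the empty set. -/
def vrCells (s : Set (Finset ℕ)) : Set (Finset (Finset ℕ)) :=
  {σ | (∀ A ∈ σ, A ∈ s) ∧ ∀ A ∈ σ, ∀ B ∈ σ, (symmDiff A B).card ≤ 2}

lemma sum_lt_sum_of_sdiff {A B : Finset ℕ} {u v : ℕ} (huv : u < v) (hv : v ∈ A \ B)
    (hu : B \ A ⊆ {u}) : ∑ x ∈ B, x < ∑ x ∈ A, x := by
  have h1 := sum_inter_add_sum_sdiff A B (fun x => x)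
  have h2 := sum_inter_add_sum_sdiff B A (fun x => x)
  have h3 : v ≤ ∑ x ∈ A \ B, x := single_le_sum (f := fun x => x) (fun _ _ => Nat.zero_le _) hv
  have h4 : ∑ x ∈ B \ A, x ≤ u := (sum_le_sum_of_subset hu).trans (by simp)
  rw [inter_comm] at h2
  omega

/-- The vertex of the Vietoris–Rips complex reached from `A` along the edge `e`; the element `0`
stands for the absence of an element. -/
def flipEdge (A e : Finset ℕ) : Finset ℕ := (symmDiff A e).erase 0

lemma symmDiff_flip {A e : Finset ℕ} (hA : 0 ∉ A) : symmDiff A (flipEdge A e) = e.erase 0 := by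
  ext x
  simp only [flipEdge, mem_symmDiff, mem_erase]
  by_cases hx : x = 0
  · subst hx; simp [hA]
  · tauto

lemma symmDiff_flip_flip (A e f : Finset ℕ) :
    symmDiff (flipEdge A e) (flipEdge A f) = (symmDiff e f).erase 0 := by
  ext x
  simp only [flipEdge, mem_symmDiff, mem_erase]
  tauto

lemma card_eq_two_of_mem_edgesTo {A e : Finset ℕ} (he : e ∈ edgesTo A) : e.card = 2 := by
  obtain ⟨u, v, huv, -, rfl⟩ := he
  exact card_pair huv.ne

lemma sum_flip_lt {A e : Finset ℕ} (he : e ∈ edgesTo A) :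
    ∑ x ∈ flipEdge A e, x < ∑ x ∈ A, x := by
  obtain ⟨u, v, huv, hv, rfl⟩ := he
  refine sum_lt_sum_of_sdiff huv (u := u) (v := v) ?_ ?_
  · simp [flipEdge, mem_symmDiff, hv]
  · intro x
    simp only [flipEdge, mem_symmDiff, mem_sdiff, mem_erase, mem_insert, mem_singleton]
    rintro ⟨⟨-, h⟩, h'⟩
    rcases h with h | ⟨rfl | rfl, -⟩
    · exact absurd h.1 h'
    · rfl
    · exact absurd hv h'

lemma card_flip_le {A e : Finset ℕ} (he : e ∈ edgesTo A) : (flipEdge A e).card ≤ A.card := by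
  obtain ⟨u, v, huv, hv, rfl⟩ := he
  have h : flipEdge A {u, v} ⊆ insert u (A.erase v) := by
    intro x
    simp only [flipEdge, mem_symmDiff, mem_erase, mem_insert, mem_singleton]
    rintro ⟨-, ⟨h, h'⟩ | ⟨rfl | rfl, h⟩⟩
    · tauto
    · tauto
    · exact absurd hv h
  refine (card_le_card h).trans ((card_insert_le _ _).trans ?_)
  rw [card_erase_of_mem hv]
  have := card_pos.mpr ⟨v, hv⟩
  omega

lemma exists_flip_eq {A B : Finset ℕ} (hA : 0 ∉ A) (hB : 0 ∉ B) (hne : A ≠ B)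
    (hd : (symmDiff A B).card ≤ 2) (hs : ∑ x ∈ B, x ≤ ∑ x ∈ A, x) :
    ∃ e ∈ edgesTo A, flipEdge A e = B := by
  have h0 : 0 ∉ symmDiff A B := by simp [mem_symmDiff, hA, hB]
  obtain ⟨u, v, huv, h⟩ : ∃ u v, u < v ∧ (insert 0 (symmDiff A B) = {u, v} ∧ u = 0 ∨
      symmDiff A B = {u, v}) := by
    have hpos : 0 < (symmDiff A B).card := by
      rw [card_pos, nonempty_iff_ne_empty]
      exact fun h => hne (symmDiff_eq_bot.mp h)
    rcases (by omega : (symmDiff A B).card = 1 ∨ (symmDiff A B).card = 2) with h | h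
    · obtain ⟨v, hv⟩ := card_eq_one.mp h
      refine ⟨0, v, Nat.pos_of_ne_zero ?_, Or.inl ⟨by rw [hv], rfl⟩⟩
      rintro rfl
      exact h0 (hv ▸ mem_singleton_self _)
    · obtain ⟨x, y, hxy, hD⟩ := card_eq_two.mp h
      rcases lt_or_gt_of_ne hxy with h | h
      · exact ⟨x, y, h, Or.inr hD⟩
      · exact ⟨y, x, h, Or.inr (hD.trans (pair_comm _ _))⟩
  have hmem : ∀ x, x ∈ symmDiff A B ↔ x ≠ 0 ∧ x ∈ ({u, v} : Finset ℕ) := by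
    intro x
    rcases h with ⟨h, rfl⟩ | h
    · rw [← h, mem_insert]
      constructor
      · exact fun hx => ⟨fun h => h0 (h ▸ hx), Or.inr hx⟩
      · rintro ⟨h1, h2⟩; exact h2.resolve_left h1
    · rw [← h]
      exact ⟨fun hx => ⟨fun h => h0 (h ▸ hx), hx⟩, fun hx => hx.2⟩
  have hv : v ∈ A := by
    by_contra hvA
    have hvD := (hmem v).mpr ⟨by omega, by simp⟩
    refine (sum_lt_sum_of_sdiff (A := B) (B := A) huv ?_ ?_).not_ge hs
    · rw [mem_symmDiff] at hvD
      rw [mem_sdiff]; tauto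
    · intro x hx
      rw [mem_sdiff] at hx
      have := ((hmem x).mp (mem_symmDiff.mpr (Or.inl hx))).2
      simp only [mem_insert, mem_singleton] at this ⊢
      rcases this with h | rfl
      · exact h
      · exact absurd hx.1 hvA
  refine ⟨{u, v}, ⟨u, v, huv, hv, rfl⟩, ?_⟩
  ext x
  have := hmem x
  rw [flipEdge, mem_erase, mem_symmDiff]
  rw [mem_symmDiff] at this
  by_cases hx : x = 0
  · subst hx; simp [hB]
  · tauto

lemma card_symmDiff_flip_flip_le_iff {A e f : Finset ℕ} (he : e ∈ edgesTo A)
    (hf : f ∈ edgesTo A) : (symmDiff (flipEdge A e) (flipEdge A f)).card ≤ 2 ↔ ¬ Disjoint e f := by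
  rw [symmDiff_flip_flip]
  have h1 := card_eq_two_of_mem_edgesTo he
  have h2 := card_eq_two_of_mem_edgesTo hf
  constructor
  · intro h hd
    rw [hd.symmDiff_eq_sup] at h
    have h3 : (e ⊔ f).card = e.card + f.card := card_union_of_disjoint hd
    have h4 := pred_card_le_card_erase (s := e ⊔ f) (a := 0)
    omega
  · intro h
    refine (card_erase_le).trans ?_
    have h3 : (symmDiff e f).card = (e \ f).card + (f \ e).card := by
      rw [symmDiff_def]
      exact card_union_of_disjoint disjoint_sdiff_sdiff
    have h4 := card_inter_add_card_sdiff e f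
    have h5 := card_inter_add_card_sdiff f e
    have h6 : 0 < (e ∩ f).card := by
      rw [card_pos, nonempty_iff_ne_empty]
      exact fun h' => h (disjoint_iff_inter_eq_empty.mpr h')
    rw [inter_comm] at h5
    omega

lemma vrCells_insert {s : Set (Finset ℕ)} {A : Finset ℕ} (hs0 : ∀ B ∈ s, 0 ∉ B) (hA0 : 0 ∉ A)
    (hsum : ∀ B ∈ s, ∑ x ∈ B, x ≤ ∑ x ∈ A, x) (hA : A ∉ s)
    (hflip : ∀ e ∈ edgesTo A, flipEdge A e ∈ s) :
    vrCells (insert A s) =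
      vrCells s ∪ (fun σ => insert A (σ.image (flipEdge A))) '' lineCliques A := by
  ext σ
  constructor
  · intro hσ
    by_cases hAσ : A ∈ σ
    · right
      have hB : ∀ B ∈ σ.erase A, ∃ e ∈ edgesTo A, flipEdge A e = B := by
        intro B hB
        obtain ⟨hne, hB⟩ := mem_erase.mp hB
        have hBs : B ∈ s := (hσ.1 B hB).resolve_left hne
        exact exists_flip_eq hA0 (hs0 B hBs) hne.symm (hσ.2 A hAσ B hB) (hsum B hBs)
      have h1 : ↑(σ.erase A) ⊆ flipEdge A '' edgesTo A := fun B hB' => hB B hB'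
      obtain ⟨τ, hτ, h2⟩ := subset_set_image_iff.mp h1
      refine ⟨τ, ⟨fun e he => hτ he, fun e he f hf => ?_⟩, ?_⟩
      · rw [← card_symmDiff_flip_flip_le_iff (hτ he) (hτ hf)]
        refine hσ.2 _ ?_ _ ?_
        · exact mem_of_mem_erase (h2 ▸ mem_image_of_mem _ he)
        · exact mem_of_mem_erase (h2 ▸ mem_image_of_mem _ hf)
      · simp only [h2, insert_erase hAσ]
    · exact Or.inl ⟨fun B hB => (hσ.1 B hB).resolve_left (by rintro rfl; exact hAσ hB), hσ.2⟩
  · rintro (hσ | ⟨τ, hτ, rfl⟩)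
    · exact ⟨fun B hB => Or.inr (hσ.1 B hB), hσ.2⟩
    · have hd : ∀ e ∈ τ, (symmDiff A (flipEdge A e)).card ≤ 2 := by
        intro e he
        rw [symmDiff_flip hA0]
        exact card_erase_le.trans (card_eq_two_of_mem_edgesTo (hτ.1 e he)).le
      constructor
      · intro B hB
        rcases mem_insert.mp hB with rfl | hB
        · exact Or.inl rfl
        · obtain ⟨e, he, rfl⟩ := mem_image.mp hB
          exact Or.inr (hflip e (hτ.1 e he))
      · intro B hB C hC
        rcases mem_insert.mp hB with rfl | hB <;> rcases mem_insert.mp hC with rfl | hC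
        · simp
        · obtain ⟨e, he, rfl⟩ := mem_image.mp hC
          exact hd e he
        · obtain ⟨e, he, rfl⟩ := mem_image.mp hB
          rw [symmDiff_comm]
          exact hd e he
        · obtain ⟨e, he, rfl⟩ := mem_image.mp hB
          obtain ⟨f, hf, rfl⟩ := mem_image.mp hC
          exact (card_symmDiff_flip_flip_le_iff (hτ.1 e he) (hτ.1 f hf)).mpr (hτ.2 e he f hf)

lemma flip_injOn {A : Finset ℕ} : Set.InjOn (flipEdge A) (edgesTo A) := by
  intro e he f hf h
  have h1 : (symmDiff e f).erase 0 = ∅ := by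
    rw [← symmDiff_flip_flip A, h, symmDiff_self]; rfl
  have h2 : ∀ x, x ≠ 0 → (x ∈ e ↔ x ∈ f) := by
    intro x hx
    have : x ∉ (symmDiff e f).erase 0 := by rw [h1]; simp
    rw [mem_erase, mem_symmDiff] at this
    tauto
  obtain ⟨u, v, huv, -, rfl⟩ := he
  obtain ⟨u', v', huv', -, rfl⟩ := hf
  have h3 := h2 u
  have h4 := h2 v
  have h5 := h2 u'
  have h6 := h2 v'
  simp at h3 h4 h5 h6
  obtain rfl : v = v' := by omega
  obtain rfl : u = u' := by omega
  rfl

lemma built_vrCells_insert {B₀ : Set (Finset (Finset ℕ))} {t : ℕ} {s : Set (Finset ℕ)}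
    {A : Finset ℕ} (hs0 : ∀ B ∈ s, 0 ∉ B) (hA0 : 0 ∉ A) (hAne : A.Nonempty)
    (hsum : ∀ B ∈ s, ∑ x ∈ B, x ≤ ∑ x ∈ A, x) (hA : A ∉ s)
    (hflip : ∀ e ∈ edgesTo A, flipEdge A e ∈ s)
    (h : Built 4 B₀ t (vrCells s)) : Built 4 B₀ (t + rA A) (vrCells (insert A s)) := by
  have ha := max'_mem A hAne
  have hmax : ∀ x ∈ A, x ≤ A.max' hAne := fun x hx => le_max' A x hx
  have hpos : 0 < A.max' hAne := Nat.pos_of_ne_zero fun h0 => hA0 (h0 ▸ ha)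
  rw [vrCells_insert hs0 hA0 hsum hA hflip, rA_eq_card_trianglesTo ha hmax]
  refine h.trans (Built.cone (flipEdge A) (edgesTo A) flip_injOn A (fun e he h => ?_)
    (fun σ hσ h => hA (hσ.1 A h)) (built_lineCliques ha hmax hpos) (fun σ hσ => hσ.1) ?_)
  · exact (sum_flip_lt he).ne (by rw [h])
  · intro σ hσ
    constructor
    · intro B hB
      obtain ⟨e, he, rfl⟩ := mem_image.mp hB
      exact hflip e (hσ.1 e he)
    · intro B hB C hC
      obtain ⟨e, he, rfl⟩ := mem_image.mp hB
      obtain ⟨f, hf, rfl⟩ := mem_image.mp hC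
      exact (card_symmDiff_flip_flip_le_iff (hσ.1 e he) (hσ.1 f hf)).mpr (hσ.2 e he f hf)

lemma built_vrCells_Fle (m n : ℕ) :
    Built 4 {∅, {∅}} (∑ A ∈ (Icc 1 m).powerset.filter (fun A => A.card ≤ n), rA A)
      (vrCells (Fle m n)) := by
  set F := (Icc 1 m).powerset.filter (fun A => A.card ≤ n) with hF
  have memF : ∀ A, A ∈ F ↔ A ⊆ Icc 1 m ∧ A.card ≤ n := by simp [hF]
  have zeroF : ∀ A ∈ F, 0 ∉ A := fun A hA h => by simpa using ((memF A).mp hA).1 h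
  have emptyF : ∅ ∈ F := by simp [hF]
  have key : ∀ s : Finset (Finset ℕ), s ⊆ F → (∀ A ∈ F, ∀ B ∈ s, ∑ x ∈ A, x < ∑ x ∈ B, x → A ∈ s) →
      s.Nonempty → Built 4 {∅, {∅}} (∑ A ∈ s, rA A) (vrCells s) := by
    intro s
    induction s using Finset.induction_on_max_value (fun A : Finset ℕ => ∑ x ∈ A, x) with
    | empty => exact fun _ _ h => absurd h (by simp)
    | insert A s hAs hmax ih =>
      intro hsub hlow _
      have hAF := hsub (mem_insert_self A s)
      have hsF : s ⊆ F := (subset_insert _ _).trans hsub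
      have hlow' : ∀ B ∈ F, ∀ C ∈ s, ∑ x ∈ B, x < ∑ x ∈ C, x → B ∈ s := by
        intro B hB C hC h
        refine (mem_insert.mp (hlow B hB C (mem_insert_of_mem hC) h)).resolve_left ?_
        rintro rfl
        exact (hmax C hC).not_gt h
      have sum_zero : ∀ B ∈ F, ∑ x ∈ B, x = 0 → B = ∅ := by
        intro B hB h
        rw [sum_eq_zero_iff] at h
        refine eq_empty_of_forall_notMem fun x hx => zeroF B hB (h x hx ▸ hx)
      rcases s.eq_empty_or_nonempty with rfl | hne
      · have hA : A = ∅ := by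
          by_contra hA
          have hpos : 0 < ∑ x ∈ A, x := Nat.pos_of_ne_zero fun h => hA (sum_zero A hAF h)
          have := hlow ∅ emptyF A (mem_insert_self _ _) (by simpa using hpos)
          simp at this
          exact hA this.symm
        subst hA
        have hr : rA ∅ = 0 := by simp [rA]
        have hc : vrCells ((insert ∅ ∅ : Finset (Finset ℕ)) : Set (Finset ℕ)) = {∅, {∅}} := by
          ext σ
          constructor
          · intro h
            have : σ ⊆ {∅} := fun B hB => by simpa using h.1 B hB
            simpa using subset_singleton_iff.mp this
          · rintro (rfl | rfl) <;> simp [vrCells]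
        rw [hc]
        simpa [hr] using Built.base
      · have hAne : A.Nonempty := by
          rw [nonempty_iff_ne_empty]
          rintro rfl
          obtain ⟨B, hB⟩ := hne
          have := sum_zero B (hsF hB) (by simpa using hmax B hB)
          exact hAs (this ▸ hB)
        rw [sum_insert hAs, add_comm, coe_insert]
        refine built_vrCells_insert (fun B hB => zeroF B (hsF hB)) (zeroF A hAF) hAne hmax
          (by simpa using hAs) (fun e he => ?_) (ih hsF hlow' hne)
        have hfF : flipEdge A e ∈ F := by
          rw [memF] at hAF ⊢
          refine ⟨?_, (card_flip_le he).trans hAF.2⟩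
          obtain ⟨u, v, huv, hv, rfl⟩ := he
          intro x
          have hvm := mem_Icc.mp (hAF.1 hv)
          simp only [flipEdge, mem_erase, mem_symmDiff, mem_insert, mem_singleton, mem_Icc]
          rintro ⟨h0, ⟨h, -⟩ | ⟨h | h, -⟩⟩
          · exact mem_Icc.mp (hAF.1 h)
          · omega
          · omega
        refine (mem_insert.mp (hlow _ hfF A (mem_insert_self _ _) (sum_flip_lt he))).resolve_left ?_
        intro h
        exact (sum_flip_lt he).ne (by rw [h])
  have hFle : (F : Set (Finset ℕ)) = Fle m n := by
    ext A; simp [hF, Fle]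
  rw [← hFle]
  exact key F subset_rfl (fun A hA _ _ _ => hA) ⟨∅, emptyF⟩

lemma sum_rA_eq_sum_tN (m n : ℕ) (hn : 2 ≤ n) :
    ∑ A ∈ (Icc 1 m).powerset.filter (fun A => A.card ≤ n), rA A = ∑ k ∈ Icc 3 n, tN m k := by
  induction n, hn using Nat.le_induction with
  | base =>
    rw [show Icc 3 2 = (∅ : Finset ℕ) from rfl, sum_empty]
    refine sum_eq_zero fun A hA => ?_
    have h : A.card - 2 = 0 := by
      have := (mem_filter.mp hA).2
      omega
    simp [rA, h]
  | succ n hn ih =>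
    rw [sum_Icc_succ_top (by omega), ← ih, tN, ← sum_union]
    · refine sum_congr ?_ fun _ _ => rfl
      ext A
      simp only [mem_filter, mem_union, mem_powerset, ← and_or_left]
      exact and_congr_right fun _ => by omega
    · refine disjoint_left.mpr fun A h1 h2 => ?_
      have := (mem_filter.mp h1).2
      have := (mem_filter.mp h2).2
      omega

end VietorisRips

section Reordering

variable {V : Type} [DecidableEq V]

lemma Built.union_disjoint {d : ℕ} {A X : Set (Finset V)} {t : ℕ} (h : Built d A t X)
    (Z : Set (Finset V)) (hZ : Disjoint X Z) : Built d (A ∪ Z) t (X ∪ Z) := by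
  induction h with
  | base => exact Built.base
  | @expand t X Y hB hE ih =>
    obtain ⟨σ, v, hv, hσ, hi, hb, rfl⟩ := hE
    rw [Set.disjoint_union_left] at hZ
    refine (ih hZ.1).expand ⟨σ, v, hv, ?_, ?_, fun ρ h1 h2 h3 => Or.inl (hb ρ h1 h2 h3), ?_⟩
    · rintro (h | h)
      · exact hσ h
      · exact Set.disjoint_left.mp hZ.2 (by simp) h
    · rintro (h | h)
      · exact hi h
      · exact Set.disjoint_left.mp hZ.2 (by simp) h
    · rw [Set.union_right_comm]
  | @attach t X τ hB hτ hb hc ih =>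
    rw [Set.disjoint_union_left] at hZ
    rw [Set.union_right_comm]
    refine (ih hZ.1).attach ?_ (fun ρ hρ => Or.inl (hb ρ hρ)) hc
    rintro (h | h)
    · exact hτ h
    · exact Set.disjoint_left.mp hZ.2 (by simp) h

/-- The attachments of a construction can be performed simultaneously, after the low-dimensional
expansions and before the high-dimensional ones. -/
lemma Built.exists_reorder {d : ℕ} {B X : Set (Finset V)} {t : ℕ} (h : Built d B t X) :
    ∃ (M : Set (Finset V)) (T : Finset (Finset V)), T.card = t ∧ Built d B 0 M ∧
      (∀ τ ∈ T, τ ∉ M ∧ τ.card = d ∧ ∀ ρ ⊂ τ, ρ ∈ M) ∧ Built d (M ∪ T) 0 X ∧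
      ∀ σ ∈ X, σ.card < d → σ ∈ M := by
  induction h with
  | base => exact ⟨B, ∅, rfl, Built.base, by simp, by simpa using Built.base, fun σ h _ => h⟩
  | @expand t X Y hB hE ih =>
    obtain ⟨M, T, hT, hM, hTM, hX, hlow⟩ := ih
    have hMX := hX.subset
    have hE' := hE
    obtain ⟨σ, v, hv, hσ, hi, hb, rfl⟩ := hE
    by_cases hd : σ.card < d
    · have hz : ∀ ρ ∈ M ∪ T, ρ ∉ ({σ, insert v σ} : Set (Finset V)) := by
        rintro ρ hρ (rfl | rfl)
        · exact hσ (hMX hρ)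
        · exact hi (hMX hρ)
      refine ⟨M ∪ {σ, insert v σ}, T, hT, hM.expand ⟨σ, v, hv, fun h => hσ (hMX (Or.inl h)),
        fun h => hi (hMX (Or.inl h)), fun ρ h1 h2 h3 => hlow ρ (hb ρ h1 h2 h3) ?_, rfl⟩, ?_, ?_, ?_⟩
      · have h4 := card_lt_card (h1.ssubset_of_ne h3)
        rw [card_insert_of_notMem hv] at h4
        omega
      · intro τ hτ
        obtain ⟨h1, h2, h3⟩ := hTM τ hτ
        refine ⟨?_, h2, fun ρ hρ => Or.inl (h3 ρ hρ)⟩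
        rintro (h | h)
        · exact h1 h
        · exact hz τ (Or.inr hτ) h
      · rw [Set.union_right_comm]
        refine hX.union_disjoint _ (Set.disjoint_left.mpr ?_)
        rintro ρ hρ (rfl | rfl)
        exacts [hσ hρ, hi hρ]
      · rintro ρ (h | h) hc
        · exact Or.inl (hlow ρ h hc)
        · exact Or.inr h
    · refine ⟨M, T, hT, hM, hTM, hX.expand hE', ?_⟩
      rintro ρ (h | rfl | rfl) hc
      · exact hlow ρ h hc
      · exact absurd hc hd
      · rw [card_insert_of_notMem hv] at hc
        omega
  | @attach t X τ hB hτ hb hc ih =>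
    obtain ⟨M, T, hT, hM, hTM, hX, hlow⟩ := ih
    have hMX := hX.subset
    refine ⟨M, insert τ T, ?_, hM, ?_, ?_, ?_⟩
    · rw [card_insert_of_notMem fun h => hτ (hMX (Or.inr h)), hT]
    · intro ρ hρ
      rcases mem_insert.mp hρ with rfl | hρ
      · exact ⟨fun h => hτ (hMX (Or.inl h)), hc, fun π hπ => hlow π (hb π hπ)
          (hc ▸ card_lt_card hπ)⟩
      · exact hTM ρ hρ
    · have h1 := hX.union_disjoint {τ} (by simpa using hτ)
      rwa [Set.union_assoc, Set.union_singleton, ← coe_insert] at h1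
    · rintro ρ (h | rfl) hc'
      · exact hlow ρ h hc'
      · omega

end Reordering

section PointedEquivalence

open ContinuousMap unitInterval

/-- Pointed homotopy equivalence of pointed spaces. -/
def PHEq (X Y : Type) [TopologicalSpace X] [TopologicalSpace Y] (x : X) (y : Y) : Prop :=
  ∃ (f : C(X, Y)) (g : C(Y, X)), f x = y ∧ g y = x ∧
    (g.comp f).HomotopicRel (.id X) {x} ∧ (f.comp g).HomotopicRel (.id Y) {y}

variable {X Y Z : Type} [TopologicalSpace X] [TopologicalSpace Y] [TopologicalSpace Z]

lemma HomotopicRel.precomp {f₀ f₁ : C(Y, Z)} {S : Set Y} (h : f₀.HomotopicRel f₁ S) (k : C(X, Y))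
    {S' : Set X} (hS : ∀ x ∈ S', k x ∈ S) : (f₀.comp k).HomotopicRel (f₁.comp k) S' := by
  obtain ⟨H⟩ := h
  exact ⟨{ toFun := fun p => H (p.1, k p.2)
           map_zero_left := fun x => H.apply_zero (k x)
           map_one_left := fun x => H.apply_one (k x)
           prop' := fun t x hx => H.prop' t (k x) (hS x hx) }⟩

lemma homotopicRel_singleton_of_eq {f g : C(X, Y)} {x : X} (H : C(I × X, Y))
    (h0 : ∀ a, H (0, a) = f a) (h1 : ∀ a, H (1, a) = g a) (hx : ∀ t, H (t, x) = f x) :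
    f.HomotopicRel g {x} :=
  ⟨{ toFun := H
     map_zero_left := h0
     map_one_left := h1
     prop' := by rintro t _ rfl; exact hx t }⟩

lemma HomotopicRel.exists_homotopy {f g : C(X, Y)} {x : X} (h : f.HomotopicRel g {x}) :
    ∃ H : C(I × X, Y), (∀ a, H (0, a) = f a) ∧ (∀ a, H (1, a) = g a) ∧ ∀ t, H (t, x) = f x := by
  obtain ⟨H⟩ := h
  exact ⟨H.toContinuousMap, H.apply_zero, H.apply_one, fun t => H.prop' t x rfl⟩

namespace PHEq

variable {x : X} {y : Y} {z : Z}

lemma refl (X : Type) [TopologicalSpace X] (x : X) : PHEq X X x x :=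
  ⟨.id X, .id X, rfl, rfl, .refl _, .refl _⟩

lemma symm (h : PHEq X Y x y) : PHEq Y X y x := by
  obtain ⟨f, g, hf, hg, h1, h2⟩ := h
  exact ⟨g, f, hg, hf, h2, h1⟩

lemma trans (h : PHEq X Y x y) (h' : PHEq Y Z y z) : PHEq X Z x z := by
  obtain ⟨f, g, hf, hg, h1, h2⟩ := h
  obtain ⟨f', g', hf', hg', h1', h2'⟩ := h'
  refine ⟨f'.comp f, g.comp g', by simp [hf, hf'], by simp [hg, hg'], ?_, ?_⟩
  · refine .trans ?_ h1
    exact (HomotopicRel.precomp h1' f (by simp [hf])).comp_continuousMap g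
  · refine .trans ?_ h2'
    exact (HomotopicRel.precomp h2 g' (by simp [hg'])).comp_continuousMap f'

lemma nonempty_homotopyEquiv (h : PHEq X Y x y) : Nonempty (ContinuousMap.HomotopyEquiv X Y) := by
  obtain ⟨f, g, -, -, ⟨h1⟩, ⟨h2⟩⟩ := h
  exact ⟨⟨f, g, ⟨h1.toHomotopy⟩, ⟨h2.toHomotopy⟩⟩⟩

lemma of_homeomorph (e : X ≃ₜ Y) (x : X) : PHEq X Y x (e x) := by
  refine ⟨e, e.symm, rfl, by simp, ?_, ?_⟩
  · convert ContinuousMap.HomotopicRel.refl _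
    ext; simp
  · convert ContinuousMap.HomotopicRel.refl _
    ext; simp

/-- A deformation retraction of subspaces gives a pointed homotopy equivalence. -/
lemma of_deformation {E : Type} [TopologicalSpace E] {A B : Set E} (hAB : A ⊆ B)
    (a : E) (ha : a ∈ A)
    (H : ℝ → E → E) (hc : Continuous fun p : ℝ × E => H p.1 p.2)
    (hB : ∀ t ∈ I, ∀ b ∈ B, H t b ∈ B) (h0 : ∀ b ∈ B, H 0 b = b) (h1 : ∀ b ∈ B, H 1 b ∈ A)
    (hA : ∀ t, ∀ b ∈ A, H t b = b) : PHEq A B ⟨a, ha⟩ ⟨a, hAB ha⟩ := by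
  refine ⟨⟨Set.inclusion hAB, continuous_inclusion hAB⟩, ⟨fun b => ⟨H 1 b, h1 b b.2⟩, ?_⟩, rfl, ?_,
    ?_, ?_⟩
  · exact (hc.comp (continuous_const.prodMk continuous_subtype_val)).subtype_mk _
  · exact Subtype.ext (hA 1 a ha)
  · refine homotopicRel_singleton_of_eq ⟨fun p => p.2, by fun_prop⟩ (fun b => ?_) (fun b => rfl)
      fun _ => ?_
    · exact Subtype.ext (hA 1 b b.2).symm
    · exact Subtype.ext (hA 1 a ha).symm
  · refine .symm (homotopicRel_singleton_of_eq ⟨fun p => ⟨H p.1 p.2, hB p.1 p.1.2 p.2 p.2.2⟩, ?_⟩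
      (fun b => ?_) (fun b => ?_) (fun t => ?_))
    · exact (hc.comp ((continuous_subtype_val.comp continuous_fst).prodMk
        (continuous_subtype_val.comp continuous_snd))).subtype_mk _
    · exact Subtype.ext (h0 b b.2)
    · rfl
    · exact Subtype.ext (hA t a ha)

end PHEq

end PointedEquivalence

section Realization

variable {V : Type}

/-- The closed geometric simplex spanned by `s`. -/
def cell (s : Finset V) : Set (V → ℝ) :=
  {f | (∀ v, 0 ≤ f v) ∧ (∀ v, f v ≠ 0 → v ∈ s) ∧ ∑ v ∈ s, f v = 1}

/-- The union of the closed geometric simplices spanned by the members of `X`. -/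
def realization (X : Set (Finset V)) : Set (V → ℝ) := {f | ∃ s ∈ X, f ∈ cell s}

lemma realization_mono {X Y : Set (Finset V)} (h : X ⊆ Y) : realization X ⊆ realization Y :=
  fun _ ⟨s, hs, hf⟩ => ⟨s, h hs, hf⟩

lemma cell_of_subset {s t : Finset V} (hts : t ⊆ s) {f : V → ℝ} (hf : f ∈ cell s)
    (h : ∀ v ∈ s, v ∉ t → f v = 0) : f ∈ cell t := by
  refine ⟨hf.1, fun v hv => ?_, ?_⟩
  · by_contra hvt
    exact hv (h v (hf.2.1 v hv) hvt)
  · rw [sum_subset hts h, hf.2.2]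

lemma cell_mono {s t : Finset V} (hst : s ⊆ t) : cell s ⊆ cell t := by
  intro f hf
  refine ⟨hf.1, fun v hv => hst (hf.2.1 v hv), ?_⟩
  rw [← hf.2.2]
  exact (sum_subset hst fun v _ hv => by_contra fun h => hv (hf.2.1 v h)).symm

lemma cell_le_one {s : Finset V} {f : V → ℝ} (hf : f ∈ cell s) (v : V) : f v ≤ 1 := by
  by_cases hv : f v = 0
  · rw [hv]; exact zero_le_one
  · rw [← hf.2.2]
    exact single_le_sum (fun w _ => hf.1 w) (hf.2.1 v hv)

lemma isClosed_cell (s : Finset V) : IsClosed (cell s) := by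
  have : cell s = (⋂ v, {f : V → ℝ | 0 ≤ f v}) ∩ ((⋂ v, ⋂ (_ : v ∉ s), {f : V → ℝ | f v = 0}) ∩
      {f : V → ℝ | ∑ v ∈ s, f v = 1}) := by
    ext f
    simp only [cell, Set.mem_inter_iff, Set.mem_iInter, Set.mem_ofPred_eq]
    refine and_congr_right fun _ => and_congr_left fun _ => forall_congr' fun v => ?_
    tauto
  rw [this]
  refine (isClosed_iInter fun v => isClosed_le continuous_const (continuous_apply v)).inter
    ((isClosed_iInter fun v => isClosed_iInter fun _ =>
      isClosed_eq (continuous_apply v) continuous_const).inter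
      (isClosed_eq (continuous_finsetSum _ fun v _ => continuous_apply v) continuous_const))

lemma isCompact_cell (s : Finset V) : IsCompact (cell s) :=
  (isCompact_univ_pi fun _ : V => isCompact_Icc (a := (0 : ℝ)) (b := 1)).of_isClosed_subset
    (isClosed_cell s) fun _ hf v _ => ⟨hf.1 v, cell_le_one hf v⟩

lemma isCompact_realization {X : Set (Finset V)} (hX : X.Finite) : IsCompact (realization X) := by
  have : realization X = ⋃ s ∈ X, cell s := by ext f; simp [realization]
  rw [this]
  exact hX.isCompact_biUnion fun s _ => isCompact_cell s

lemma mem_of_pos {X : Set (Finset V)} (hX : IsLowerSet X) {f : V → ℝ} (hf : f ∈ realization X)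
    {σ : Finset V} (h : ∀ w ∈ σ, 0 < f w) : σ ∈ X := by
  obtain ⟨s, hs, hf⟩ := hf
  exact hX (fun w hw => hf.2.1 w (h w hw).ne') hs

variable [DecidableEq V]

lemma single_mem_cell (p : V) : Pi.single p (1 : ℝ) ∈ cell {p} := by
  refine ⟨fun v => ?_, fun v hv => ?_, by simp⟩
  · by_cases h : v = p
    · subst h; simp
    · simp [h]
  · by_contra h
    simp at h
    simp [h] at hv

lemma single_mem_realization {X : Set (Finset V)} {p : V} (hp : {p} ∈ X) :
    Pi.single p (1 : ℝ) ∈ realization X := ⟨{p}, hp, single_mem_cell p⟩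

lemma ElemExp.pHEq {X Y : Set (Finset V)} (hX : IsLowerSet X) (h0 : ∅ ∈ X) {p : V} (hp : {p} ∈ X)
    (hE : ElemExp X Y) (hpY : {p} ∈ Y) :
    PHEq (realization X) (realization Y) ⟨_, single_mem_realization hp⟩
      ⟨_, single_mem_realization hpY⟩ := by
  obtain ⟨σ, v, hv, hσ, hi, hb, rfl⟩ := hE
  have hne : σ.Nonempty := by
    rw [nonempty_iff_ne_empty]; rintro rfl; exact hσ h0
  set μ : (V → ℝ) → ℝ := fun f => σ.inf' hne fun w => f w with hμ
  have hμc : Continuous μ := Continuous.finset_inf'_apply hne fun w _ => continuous_apply w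
  have hμle : ∀ f, ∀ w ∈ σ, μ f ≤ f w := fun f w hw => inf'_le _ hw
  have hμ0 : ∀ f, (∀ w, 0 ≤ f w) → 0 ≤ μ f := fun f hf => le_inf' _ _ fun w _ => hf w
  have hμX : ∀ f ∈ realization X, μ f = 0 := by
    intro f hf
    have hn : ∀ w, 0 ≤ f w := by obtain ⟨s, -, h⟩ := hf; exact h.1
    by_contra h
    exact hσ (mem_of_pos hX hf fun w hw =>
      ((hμ0 f hn).lt_of_ne (Ne.symm h)).trans_le (hμle f w hw))
  set d : V → ℝ := fun w => if w = v then (σ.card : ℝ) else if w ∈ σ then -1 else 0 with hd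
  set H : ℝ → (V → ℝ) → V → ℝ := fun t f w => f w + t * μ f * d w with hH
  have hHc : Continuous fun p : ℝ × (V → ℝ) => H p.1 p.2 := by
    refine continuous_pi fun w => ?_
    simp only [hH]
    have := hμc.comp (continuous_snd (X := ℝ))
    simp only [Function.comp_def] at this
    fun_prop
  have hA : ∀ t, ∀ f ∈ realization X, H t f = f := by
    intro t f hf
    ext w
    simp [hH, hμX f hf]
  have hcellY : ∀ f ∈ realization (X ∪ {σ, insert v σ}),
      f ∈ realization X ∨ f ∈ cell (insert v σ) := by
    rintro f ⟨s, (hs | rfl | rfl), hf⟩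
    · exact Or.inl ⟨s, hs, hf⟩
    · exact Or.inr (cell_mono (subset_insert _ _) hf)
    · exact Or.inr hf
  have hcell : ∀ t ∈ unitInterval, ∀ f ∈ cell (insert v σ), H t f ∈ cell (insert v σ) := by
    rintro t ⟨ht0, ht1⟩ f hf
    have hm := hμ0 f hf.1
    refine ⟨fun w => ?_, fun w hw => ?_, ?_⟩
    · simp only [hH, hd]
      split_ifs with h1 h2
      · have := hf.1 w
        positivity
      · have h3 := hμle f w h2
        nlinarith
      · simpa using hf.1 w
    · by_contra h
      rw [mem_insert, not_or] at h
      have h1 : f w = 0 := by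
        by_contra h'
        have := hf.2.1 w h'
        rw [mem_insert] at this
        tauto
      exact hw (by simp [hH, hd, h.1, h.2, h1])
    · have h2 : ∑ w ∈ insert v σ, d w = 0 := by
        rw [sum_insert hv]
        have : ∑ w ∈ σ, d w = ∑ w ∈ σ, (-1 : ℝ) := by
          refine sum_congr rfl fun w hw => ?_
          have : w ≠ v := by rintro rfl; exact hv hw
          simp [hd, this, hw]
        rw [this]
        simp [hd]
      simp only [hH]
      rw [sum_add_distrib, hf.2.2, ← mul_sum, h2]
      simp
  refine PHEq.of_deformation (realization_mono Set.subset_union_left) _ _ H hHc ?_ ?_ ?_ hA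
  · intro t ht f hf
    rcases hcellY f hf with h | h
    · rw [hA t f h]; exact hf
    · exact ⟨_, by simp, hcell t ht f h⟩
  · intro f _
    ext w
    simp [hH]
  · intro f hf
    rcases hcellY f hf with h | h
    · rw [hA 1 f h]; exact h
    · obtain ⟨w, hw, hmin⟩ := exists_mem_eq_inf' hne fun w => f w
      have hwv : w ≠ v := by rintro rfl; exact hv hw
      have hz : H 1 f w = 0 := by
        simp only [hH, hd, if_neg hwv, if_pos hw, hμ, hmin]; ring
      refine ⟨(insert v σ).erase w, hb _ (erase_subset _ _) ?_ ?_, ?_⟩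
      · intro h
        exact hv (h ▸ mem_erase.mpr ⟨hwv.symm, mem_insert_self _ _⟩)
      · intro h
        have h' := notMem_erase w (insert v σ)
        rw [h] at h'
        exact h' (mem_insert_of_mem hw)
      · refine cell_of_subset (erase_subset _ _) (hcell 1 ⟨zero_le_one, le_rfl⟩ f h)
          fun u hu hu' => ?_
        have : u = w := by
          by_contra h
          exact hu' (mem_erase.mpr ⟨h, hu⟩)
        rw [this, hz]

lemma Built.pHEq {d : ℕ} {X Y : Set (Finset V)} (h : Built d X 0 Y) (hX : IsLowerSet X) (h0 : ∅ ∈ X)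
    {p : V} (hp : {p} ∈ X) (hpY : {p} ∈ Y) :
    PHEq (realization X) (realization Y) ⟨_, single_mem_realization hp⟩
      ⟨_, single_mem_realization hpY⟩ := by
  generalize ht : 0 = t at h
  induction h with
  | base => exact PHEq.refl _ _
  | expand hB hE ih =>
    have hp' := hB.subset hp
    exact (ih hp' ht).trans (hE.pHEq (hB.isLowerSet hX) (hB.subset h0) hp' hpY)
  | attach => omega

lemma realization_point_subsingleton (p : V) :
    (realization ({∅, {p}} : Set (Finset V))).Subsingleton := by
  have key : ∀ f ∈ realization ({∅, {p}} : Set (Finset V)), f = Pi.single p 1 := by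
    rintro f ⟨s, (rfl | rfl), hf⟩
    · exact absurd hf.2.2 (by simp)
    · ext v
      by_cases hv : v = p
      · subst hv; simpa using hf.2.2
      · have : f v = 0 := by
          by_contra h
          exact hv (by simpa using hf.2.1 v h)
        simp [hv, this]
  intro f hf g hg
  rw [key f hf, key g hg]

/-- A complex built from a point by expansions is contractible relative to that point. -/
lemma Built.exists_contraction {d : ℕ} {p : V} {M : Set (Finset V)} (h : Built d {∅, {p}} 0 M)
    (hp : {p} ∈ M) :
    ∃ H : C(unitInterval × realization M, realization M), (∀ f, H (0, f) = f) ∧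
      (∀ f, H (1, f) = ⟨_, single_mem_realization hp⟩) ∧
      ∀ t, H (t, ⟨_, single_mem_realization hp⟩) = ⟨_, single_mem_realization hp⟩ := by
  have hlow : IsLowerSet ({∅, {p}} : Set (Finset V)) := by
    rintro a b hb (rfl | rfl)
    · exact Or.inl (subset_empty.mp hb)
    · exact (subset_singleton_iff.mp hb)
  obtain ⟨f, g, hf, hg, -, h2⟩ := h.pHEq hlow (by simp) (p := p) (by simp) hp
  obtain ⟨H, H0, H1, H2⟩ := HomotopicRel.exists_homotopy h2.symm
  refine ⟨H, H0, fun a => ?_, H2⟩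
  rw [H1, ContinuousMap.comp_apply, ← hf]
  congr 1
  exact Subtype.ext (realization_point_subsingleton p (g a).2 (single_mem_realization (by simp)))

end Realization

section SimplexSphere

/-- Four times the smallest of four numbers; on the standard simplex, it is `1` exactly at the
barycenter and `0` exactly on the boundary. -/
noncomputable def depth (a : Fin 4 → ℝ) : ℝ := 4 * univ.inf' univ_nonempty fun j => a j

lemma continuous_depth : Continuous depth :=
  continuous_const.mul (Continuous.finset_inf'_apply _ fun j _ => continuous_apply j)

lemma depth_le (a : Fin 4 → ℝ) (j : Fin 4) : depth a ≤ 4 * a j :=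
  mul_le_mul_of_nonneg_left (inf'_le _ (mem_univ j)) (by norm_num)

lemma exists_depth_eq (a : Fin 4 → ℝ) : ∃ j, depth a = 4 * a j := by
  obtain ⟨j, -, hj⟩ := exists_mem_eq_inf' (univ_nonempty (α := Fin 4)) fun j => a j
  exact ⟨j, by rw [depth, hj]⟩

lemma depth_nonneg {a : Fin 4 → ℝ} (ha : ∀ j, 0 ≤ a j) : 0 ≤ depth a := by
  obtain ⟨j, hj⟩ := exists_depth_eq a
  have := ha j
  linarith

lemma depth_le_one {a : Fin 4 → ℝ} (hs : ∑ j, a j = 1) : depth a ≤ 1 := by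
  rw [Fin.sum_univ_four] at hs
  have h0 := depth_le a 0
  have h1 := depth_le a 1
  have h2 := depth_le a 2
  have h3 := depth_le a 3
  linarith

lemma eq_quarter_of_depth_eq_one {a : Fin 4 → ℝ} (hs : ∑ j, a j = 1) (h : depth a = 1) (j : Fin 4) :
    a j = 1 / 4 := by
  rw [Fin.sum_univ_four] at hs
  have h0 := depth_le a 0
  have h1 := depth_le a 1
  have h2 := depth_le a 2
  have h3 := depth_le a 3
  fin_cases j <;> simp <;> linarith

/-- A vector whose direction parametrizes the quotient of the simplex by its boundary. -/
noncomputable def simplexVec (a : Fin 4 → ℝ) : EuclideanSpace ℝ (Fin 4) :=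
  WithLp.toLp 2 ![1 - 2 * depth a, depth a * (a 0 - 1 / 4), depth a * (a 1 - 1 / 4),
    depth a * (a 2 - 1 / 4)]

lemma continuous_simplexVec : Continuous simplexVec := by
  refine (PiLp.continuous_toLp 2 _).comp (continuous_pi fun j => ?_)
  have := continuous_depth
  fin_cases j <;> simp <;> fun_prop

lemma simplexVec_ne_zero {a : Fin 4 → ℝ} (hs : ∑ j, a j = 1) : simplexVec a ≠ 0 := by
  intro h
  have e0 : simplexVec a 0 = 0 := by rw [h]; rfl
  have e1 : simplexVec a 1 = 0 := by rw [h]; rfl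
  have e2 : simplexVec a 2 = 0 := by rw [h]; rfl
  have e3 : simplexVec a 3 = 0 := by rw [h]; rfl
  simp [simplexVec] at e0 e1 e2 e3
  have hd : depth a = 1 / 2 := by linarith
  rw [hd] at e1 e2 e3
  rw [Fin.sum_univ_four] at hs
  obtain ⟨j, hj⟩ := exists_depth_eq a
  norm_num at e1 e2 e3
  fin_cases j <;> simp at hj <;> linarith

/-- The map collapsing the boundary of the standard `3`-simplex. -/
noncomputable def simplexToSphere (a : stdSimplex ℝ (Fin 4)) : Sph 3 :=
  ⟨‖simplexVec a.1‖⁻¹ • simplexVec a.1, by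
    rw [mem_sphere_zero_iff_norm, norm_smul, norm_inv, norm_norm,
      inv_mul_cancel₀ (norm_ne_zero_iff.mpr (simplexVec_ne_zero a.2.2))]⟩

lemma continuous_simplexToSphere : Continuous simplexToSphere := by
  refine Continuous.subtype_mk ?_ _
  have h := continuous_simplexVec.comp (continuous_subtype_val (p := (· ∈ stdSimplex ℝ (Fin 4))))
  exact (h.norm.inv₀ fun a => norm_ne_zero_iff.mpr (simplexVec_ne_zero a.2.2)).smul h

lemma simplexToSphere_of_smul {a : stdSimplex ℝ (Fin 4)} {x : Sph 3} {c : ℝ} (hc : 0 < c)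
    (h : simplexVec a.1 = c • (x : EuclideanSpace ℝ (Fin 4))) : simplexToSphere a = x := by
  apply Subtype.ext
  have hx : ‖(x : EuclideanSpace ℝ (Fin 4))‖ = 1 := mem_sphere_zero_iff_norm.mp x.2
  simp only [simplexToSphere]
  rw [h, norm_smul, hx, mul_one, Real.norm_of_nonneg hc.le, smul_smul, inv_mul_cancel₀ hc.ne',
    one_smul]

lemma simplexToSphere_of_depth_eq_zero {a : stdSimplex ℝ (Fin 4)} (h : depth a.1 = 0) :
    simplexToSphere a = sphBase 3 := by
  refine simplexToSphere_of_smul one_pos ?_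
  ext j
  fin_cases j <;> simp [simplexVec, h, sphBase]

lemma simplexToSphere_injective {a b : stdSimplex ℝ (Fin 4)}
    (h : simplexToSphere a = simplexToSphere b) : a = b ∨ depth a.1 = 0 ∧ depth b.1 = 0 := by
  have ha := simplexVec_ne_zero a.2.2
  have hb := simplexVec_ne_zero b.2.2
  obtain ⟨c, hc, hab⟩ : ∃ c : ℝ, 0 < c ∧ simplexVec a.1 = c • simplexVec b.1 := by
    refine ⟨‖simplexVec a.1‖ * ‖simplexVec b.1‖⁻¹, by positivity, ?_⟩
    have h' := congrArg Subtype.val h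
    simp only [simplexToSphere] at h'
    rw [mul_smul, ← h', smul_smul, mul_inv_cancel₀ (norm_ne_zero_iff.mpr ha), one_smul]
  have e0 : simplexVec a.1 0 = c * simplexVec b.1 0 := by rw [hab]; rfl
  have e1 : simplexVec a.1 1 = c * simplexVec b.1 1 := by rw [hab]; rfl
  have e2 : simplexVec a.1 2 = c * simplexVec b.1 2 := by rw [hab]; rfl
  have e3 : simplexVec a.1 3 = c * simplexVec b.1 3 := by rw [hab]; rfl
  simp only [simplexVec] at e0 e1 e2 e3
  simp at e0 e1 e2 e3
  have sa := a.2.2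
  have sb := b.2.2
  have ua := depth_le_one sa
  have ub := depth_le_one sb
  have la := depth_nonneg a.2.1
  have lb := depth_nonneg b.2.1
  have hj : ∀ j, depth a.1 * (a.1 j - 1 / 4) = c * (depth b.1 * (b.1 j - 1 / 4)) := by
    intro j
    rw [Fin.sum_univ_four] at sa sb
    fin_cases j
    · show depth a.1 * (a.1 0 - 1 / 4) = c * (depth b.1 * (b.1 0 - 1 / 4))
      linear_combination e1
    · show depth a.1 * (a.1 1 - 1 / 4) = c * (depth b.1 * (b.1 1 - 1 / 4))
      linear_combination e2
    · show depth a.1 * (a.1 2 - 1 / 4) = c * (depth b.1 * (b.1 2 - 1 / 4))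
      linear_combination e3
    · have h1 : a.1 3 = 1 - a.1 0 - a.1 1 - a.1 2 := by linarith
      have h2 : b.1 3 = 1 - b.1 0 - b.1 1 - b.1 2 := by linarith
      simp only [Fin.reduceFinMk]
      rw [h1, h2]
      norm_num at e1 e2 e3 ⊢
      linear_combination -e1 - e2 - e3
  have key : depth a.1 * (1 - depth a.1) = c * (depth b.1 * (1 - depth b.1)) := by
    apply le_antisymm
    · obtain ⟨j, hj'⟩ := exists_depth_eq a.1
      have h1 : depth a.1 * (1 - depth a.1) = -4 * (depth a.1 * (a.1 j - 1 / 4)) := by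
        nth_rewrite 2 [hj']; ring
      have h2 : depth b.1 * (b.1 j - 1 / 4) ≥ depth b.1 * ((depth b.1 - 1) / 4) :=
        mul_le_mul_of_nonneg_left (by linarith [depth_le b.1 j]) lb
      rw [h1, hj]
      nlinarith
    · obtain ⟨j, hj'⟩ := exists_depth_eq b.1
      have h1 : c * (depth b.1 * (1 - depth b.1)) = -4 * (c * (depth b.1 * (b.1 j - 1 / 4))) := by
        nth_rewrite 2 [hj']; ring
      have h2 : depth a.1 * (a.1 j - 1 / 4) ≥ depth a.1 * ((depth a.1 - 1) / 4) :=
        mul_le_mul_of_nonneg_left (by linarith [depth_le a.1 j]) la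
      rw [h1, ← hj]
      linarith
  have hd : depth a.1 = depth b.1 := by
    have h1 : (depth b.1 - depth a.1) *
        ((1 - depth a.1) * (1 - depth b.1) + depth a.1 * depth b.1) = 0 := by
      have : c * ((depth b.1 - depth a.1) *
          ((1 - depth a.1) * (1 - depth b.1) + depth a.1 * depth b.1)) = 0 := by
        linear_combination (c * depth b.1 * (1 - depth b.1)) * e0 - c * (1 - 2 * depth b.1) * key
      exact (mul_eq_zero.mp this).resolve_left hc.ne'
    rcases mul_eq_zero.mp h1 with h2 | h2
    · linarith
    · have h3 : (1 - depth a.1) * (1 - depth b.1) = 0 := by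
        nlinarith [mul_nonneg la lb, mul_nonneg (sub_nonneg.mpr ua) (sub_nonneg.mpr ub)]
      have h4 : depth a.1 * depth b.1 = 0 := by linarith
      rcases mul_eq_zero.mp h3 with h5 | h5 <;> rcases mul_eq_zero.mp h4 with h6 | h6
      · linarith
      · rw [h6] at e0; have : depth a.1 = 1 := by linarith
        rw [this] at e0; linarith
      · rw [h6] at e0; have : depth b.1 = 1 := by linarith
        rw [this] at e0; linarith
      · linarith
  rcases la.eq_or_lt with h0 | h0
  · exact Or.inr ⟨h0.symm, hd ▸ h0.symm⟩
  · left
    apply Subtype.ext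
    ext j
    rcases ua.eq_or_lt with h1 | h1
    · rw [eq_quarter_of_depth_eq_one sa h1, eq_quarter_of_depth_eq_one sb (hd ▸ h1)]
    · have hc1 : c = 1 := by
        rw [← hd] at key
        have : (c - 1) * (depth a.1 * (1 - depth a.1)) = 0 := by linarith
        rcases mul_eq_zero.mp this with h | h
        · linarith
        · exact absurd h (mul_pos h0 (by linarith)).ne'
      have := hj j
      rw [← hd, hc1, one_mul] at this
      have := mul_left_cancel₀ h0.ne' this
      linarith

lemma simplexToSphere_surjective : Function.Surjective simplexToSphere := by
  intro x
  have hx : ‖(x : EuclideanSpace ℝ (Fin 4))‖ = 1 := mem_sphere_zero_iff_norm.mp x.2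
  have hx2 : x.1 0 ^ 2 + x.1 1 ^ 2 + x.1 2 ^ 2 + x.1 3 ^ 2 = 1 := by
    have := EuclideanSpace.real_norm_sq_eq x.1
    rw [hx, Fin.sum_univ_four] at this
    linarith
  set y : Fin 4 → ℝ := ![x.1 1, x.1 2, x.1 3, -(x.1 1 + x.1 2 + x.1 3)] with hy
  have ysum : y 0 + y 1 + y 2 + y 3 = 0 := by simp [hy]
  have le0 := depth_le y 0
  have le1 := depth_le y 1
  have le2 := depth_le y 2
  have le3 := depth_le y 3
  by_cases hN : 0 ≤ depth y
  · have y0 : x.1 1 = 0 := by show y 0 = 0; linarith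
    have y1 : x.1 2 = 0 := by show y 1 = 0; linarith
    have y2 : x.1 3 = 0 := by show y 2 = 0; linarith
    rw [y0, y1, y2] at hx2
    have : (x.1 0 - 1) * (x.1 0 + 1) = 0 := by linarith
    rcases mul_eq_zero.mp this with h | h
    · set a : Fin 4 → ℝ := Pi.single 0 1 with ha0
      have hmem : a ∈ stdSimplex ℝ (Fin 4) := single_mem_stdSimplex ℝ 0
      have ha : depth a = 0 := by
        refine le_antisymm ?_ (depth_nonneg hmem.1)
        have := depth_le a 1
        simpa [ha0] using this
      refine ⟨⟨a, hmem⟩, (simplexToSphere_of_depth_eq_zero ha).trans (Subtype.ext ?_)⟩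
      ext j
      fin_cases j <;> simp [sphBase, y0, y1, y2]
      linarith
    · set a : Fin 4 → ℝ := fun _ => 1 / 4 with ha0
      have hmem : a ∈ stdSimplex ℝ (Fin 4) := ⟨fun _ => by norm_num [ha0], by simp [ha0]⟩
      have ha : depth a = 1 := by
        obtain ⟨j, hj⟩ := exists_depth_eq a
        rw [hj]; simp [ha0]
      refine ⟨⟨a, hmem⟩, simplexToSphere_of_smul one_pos ?_⟩
      ext j
      fin_cases j <;> simp [simplexVec, y0, y1, y2, ha0]
      linarith
  · push Not at hN
    set N := -depth y with hN'
    have hNpos : 0 < N := by linarith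
    obtain ⟨μ, ⟨hμ0, hμ1⟩, hμ⟩ : ∃ μ ∈ Set.Ioo (0 : ℝ) 1,
        (1 - 2 * μ) - x.1 0 * (μ * (1 - μ) / N) = 0 := by
      have := intermediate_value_Ioo' (a := (0 : ℝ)) (b := 1) zero_le_one
        (f := fun μ => (1 - 2 * μ) - x.1 0 * (μ * (1 - μ) / N)) (by fun_prop)
      exact this (by norm_num)
    have hNle : ∀ j, -N ≤ 4 * y j := fun j => by rw [hN', neg_neg]; exact depth_le y j
    have hs : ∑ j, (1 / 4 + (1 - μ) / N * y j) = 1 := by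
      rw [Fin.sum_univ_four]
      linear_combination ((1 - μ) / N) * ysum
    have hdiv : 0 < (1 - μ) / N := div_pos (by linarith) hNpos
    have hge : ∀ j, μ ≤ 4 * (1 / 4 + (1 - μ) / N * y j) := by
      intro j
      have h1 := mul_le_mul_of_nonneg_left (hNle j) hdiv.le
      have h2 : (1 - μ) / N * -N = -(1 - μ) := by field_simp
      linarith
    set a : Fin 4 → ℝ := fun j => 1 / 4 + (1 - μ) / N * y j with ha0
    have hmem : a ∈ stdSimplex ℝ (Fin 4) := ⟨fun j =>
      show 0 ≤ 1 / 4 + (1 - μ) / N * y j by linarith [hge j], hs⟩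
    have ha : depth a = μ := by
      apply le_antisymm
      · obtain ⟨j, hj⟩ := exists_depth_eq y
        refine (depth_le a j).trans_eq ?_
        have h1 : 4 * y j = -N := by rw [← hj, hN', neg_neg]
        have h2 : (1 - μ) / N * -N = -(1 - μ) := by field_simp
        show 4 * (1 / 4 + (1 - μ) / N * y j) = μ
        linear_combination ((1 - μ) / N) * h1 + h2
      · obtain ⟨j, hj⟩ := exists_depth_eq a
        rw [hj]
        exact hge j
    refine ⟨⟨a, hmem⟩, simplexToSphere_of_smul (c := μ * (1 - μ) / N)
      (div_pos (mul_pos hμ0 (by linarith)) hNpos) ?_⟩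
    ext j
    fin_cases j
    · simp [simplexVec, ha]; linarith
    · show depth a * (a 0 - 1 / 4) = μ * (1 - μ) / N * y 0
      rw [ha, ha0]; ring
    · show depth a * (a 1 - 1 / 4) = μ * (1 - μ) / N * y 1
      rw [ha, ha0]; ring
    · show depth a * (a 2 - 1 / 4) = μ * (1 - μ) / N * y 2
      rw [ha, ha0]; ring

end SimplexSphere

section Collapse

/-- If a subspace deforms to a point within itself by a deformation of the whole compact space,
then collapsing it to a point is a homotopy equivalence. -/
lemma PHEq.of_collapse {X W : Type} [TopologicalSpace X] [TopologicalSpace W] [CompactSpace X]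
    [T2Space W] (q : C(X, W)) (hq : Function.Surjective q) {A : Set X} {x₀ : X}
    (hker : ∀ a b, q a = q b ↔ a = b ∨ a ∈ A ∧ b ∈ A) (H : C(unitInterval × X, X))
    (h0 : ∀ a, H (0, a) = a) (hA : ∀ t, ∀ a ∈ A, H (t, a) ∈ A) (h1 : ∀ a ∈ A, H (1, a) = x₀)
    (hb : ∀ t, H (t, x₀) = x₀) : PHEq X W x₀ (q x₀) := by
  have hQ : Topology.IsQuotientMap q := q.continuous.isClosedMap.isQuotientMap q.continuous hq
  let q' : C(unitInterval × X, unitInterval × W) := (ContinuousMap.id _).prodMap q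
  have hq' : Function.Surjective q' := Function.surjective_id.prodMap hq
  have hQ' : Topology.IsQuotientMap q' :=
    q'.continuous.isClosedMap.isQuotientMap q'.continuous hq'
  let H₁ : C(X, X) :=
    H.comp ((ContinuousMap.const X (1 : unitInterval)).prodMk (ContinuousMap.id X))
  have hH₁ : Function.FactorsThrough H₁ q := by
    intro a b hab
    rcases (hker a b).mp hab with rfl | ⟨ha, hb⟩
    · rfl
    · exact (h1 a ha).trans (h1 b hb).symm
  let g : C(W, X) := hQ.lift H₁ hH₁
  have hg : ∀ a, g (q a) = H (1, a) := fun a =>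
    congrArg (fun k : C(X, X) => k a) (hQ.lift_comp H₁ hH₁)
  have hqH : Function.FactorsThrough (q.comp H) q' := by
    rintro ⟨t, a⟩ ⟨s, b⟩ hab
    obtain ⟨rfl, hq_eq⟩ : t = s ∧ q a = q b := Prod.ext_iff.mp hab
    rcases (hker a b).mp hq_eq with rfl | ⟨ha, hb⟩
    · rfl
    · exact (hker _ _).mpr (Or.inr ⟨hA t a ha, hA t b hb⟩)
  let K : C(unitInterval × W, W) := hQ'.lift (q.comp H) hqH
  have hK : ∀ t a, K (t, q a) = q (H (t, a)) := fun t a =>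
    congrArg (fun k : C(unitInterval × X, W) => k (t, a)) (hQ'.lift_comp (q.comp H) hqH)
  refine ⟨q, g, rfl, (hg x₀).trans (hb 1), ?_, ?_⟩
  · refine (homotopicRel_singleton_of_eq H ?_ ?_ ?_).symm
    · exact h0
    · exact fun a => (hg a).symm
    · exact hb
  · refine (homotopicRel_singleton_of_eq K ?_ ?_ ?_).symm
    · intro w
      obtain ⟨a, rfl⟩ := hq w
      rw [hK, h0]; rfl
    · intro w
      obtain ⟨a, rfl⟩ := hq w
      rw [hK, ContinuousMap.comp_apply, hg]
    · intro t
      rw [hK, hb]; rfl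

end Collapse

section TopCells

variable {V : Type}

/-- The depth of a point with respect to the cell with vertices `u 0, …, u 3`. -/
noncomputable def quadDepth (u : Fin 4 → V) (f : V → ℝ) : ℝ := depth fun j => f (u j)

lemma continuous_quadDepth (u : Fin 4 → V) : Continuous (quadDepth u) :=
  continuous_depth.comp (continuous_pi fun j => continuous_apply (u j))

variable [DecidableEq V]

/-- The cell with vertices `u 0, …, u 3`. -/
def quad (u : Fin 4 → V) : Finset V := univ.image u

/-- The barycenter of the cell `quad u`. -/
noncomputable def quadCenter (u : Fin 4 → V) (v : V) : ℝ := if v ∈ quad u then 1 / 4 else 0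

lemma mem_quad (u : Fin 4 → V) (j : Fin 4) : u j ∈ quad u := mem_image_of_mem _ (mem_univ j)

lemma sum_quad {u : Fin 4 → V} (hu : Function.Injective u) (f : V → ℝ) :
    ∑ v ∈ quad u, f v = ∑ j, f (u j) := sum_image fun _ _ _ _ h => hu h

lemma card_quad {u : Fin 4 → V} (hu : Function.Injective u) : (quad u).card = 4 := by
  rw [quad, card_image_of_injective _ hu, card_univ, Fintype.card_fin]

lemma mem_stdSimplex_of_mem_cell {u : Fin 4 → V} (hu : Function.Injective u) {f : V → ℝ}
    (hf : f ∈ cell (quad u)) : (fun j => f (u j)) ∈ stdSimplex ℝ (Fin 4) :=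
  ⟨fun j => hf.1 _, by rw [← sum_quad hu, hf.2.2]⟩

lemma eq_of_mem_cell_quad {u : Fin 4 → V} {f g : V → ℝ} (hf : f ∈ cell (quad u))
    (hg : g ∈ cell (quad u)) (h : ∀ j, f (u j) = g (u j)) : f = g := by
  ext v
  by_cases hv : v ∈ quad u
  · obtain ⟨j, -, rfl⟩ := mem_image.mp hv
    exact h j
  · rw [by_contra fun h => hv (hf.2.1 v h), by_contra fun h => hv (hg.2.1 v h)]

lemma exists_mem_cell_quad {u : Fin 4 → V} (hu : Function.Injective u) {a : Fin 4 → ℝ}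
    (ha : a ∈ stdSimplex ℝ (Fin 4)) : ∃ f ∈ cell (quad u), ∀ j, f (u j) = a j := by
  have hj : ∀ j, ∑ k, (if u k = u j then a k else 0) = a j := fun j => by simp [hu.eq_iff]
  refine ⟨fun v => ∑ k, if u k = v then a k else 0, ⟨fun v => ?_, fun v hv => ?_, ?_⟩, hj⟩
  · exact sum_nonneg fun k _ => by split_ifs; exacts [ha.1 k, le_rfl]
  · obtain ⟨k, -, hk⟩ := exists_ne_zero_of_sum_ne_zero hv
    by_cases h : u k = v
    · exact h ▸ mem_quad u k
    · simp [h] at hk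
  · rw [sum_quad hu, sum_congr rfl fun j _ => hj j, ha.2]

/-- Four-vertex cells `quad (vert i)`, pairwise distinct, attached to `M` along their full
boundaries. -/
structure QuadsAttached (M : Set (Finset V)) {t : ℕ} (vert : Fin t → Fin 4 → V) : Prop where
  lower : IsLowerSet M
  finite : M.Finite
  inj : ∀ i, Function.Injective (vert i)
  notMem : ∀ i, quad (vert i) ∉ M
  boundary : ∀ i, ∀ ρ ⊂ quad (vert i), ρ ∈ M
  distinct : Function.Injective fun i => quad (vert i)

namespace QuadsAttached

variable {M : Set (Finset V)} {t : ℕ} {vert : Fin t → Fin 4 → V}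

lemma depth_eq_zero_of_mem (h : QuadsAttached M vert) {f : V → ℝ} (hf : f ∈ realization M)
    (i : Fin t) : quadDepth (vert i) f = 0 := by
  obtain ⟨s, hs, hfs⟩ := id hf
  refine le_antisymm (not_lt.mp fun hlt => h.notMem i ?_) (depth_nonneg fun j => hfs.1 _)
  refine mem_of_pos h.lower hf fun w hw => ?_
  obtain ⟨j, -, rfl⟩ := mem_image.mp hw
  have := depth_le (fun j => f (vert i j)) j
  rw [quadDepth] at hlt
  linarith

lemma mem_of_apply_eq_zero (h : QuadsAttached M vert) {f : V → ℝ} {i : Fin t}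
    (hf : f ∈ cell (quad (vert i))) {j : Fin 4} (h0 : f (vert i j) = 0) : f ∈ realization M := by
  refine ⟨(quad (vert i)).erase (vert i j), h.boundary i _ (erase_ssubset (mem_quad _ j)),
    cell_of_subset (erase_subset _ _) hf fun v hv hv' => ?_⟩
  have : v = vert i j := by by_contra hne; exact hv' (mem_erase.mpr ⟨hne, hv⟩)
  rw [this, h0]

lemma mem_of_depth_eq_zero (h : QuadsAttached M vert) {f : V → ℝ} {i : Fin t}
    (hf : f ∈ cell (quad (vert i))) (h0 : quadDepth (vert i) f = 0) : f ∈ realization M := by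
  obtain ⟨j, hj⟩ := exists_depth_eq fun j => f (vert i j)
  rw [quadDepth] at h0
  exact h.mem_of_apply_eq_zero hf (j := j) (by linarith)

lemma depth_eq_zero_of_ne (h : QuadsAttached M vert) {f : V → ℝ} {i k : Fin t}
    (hf : f ∈ cell (quad (vert i))) (hk : k ≠ i) : quadDepth (vert k) f = 0 := by
  refine le_antisymm (not_lt.mp fun hlt => hk (h.distinct ?_)) (depth_nonneg fun j => hf.1 _)
  refine eq_of_subset_of_card_le (fun w hw => hf.2.1 w ?_)
    (by rw [card_quad (h.inj _), card_quad (h.inj _)])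
  obtain ⟨j, -, rfl⟩ := mem_image.mp hw
  have := depth_le (fun j => f (vert k j)) j
  rw [quadDepth] at hlt
  intro h0
  linarith

lemma mem_union_iff {f : V → ℝ} : f ∈ realization (M ∪ Set.range fun i => quad (vert i)) ↔
    f ∈ realization M ∨ ∃ i, f ∈ cell (quad (vert i)) := by
  constructor
  · rintro ⟨s, hs | ⟨i, rfl⟩, hf⟩
    exacts [Or.inl ⟨s, hs, hf⟩, Or.inr ⟨i, hf⟩]
  · rintro (⟨s, hs, hf⟩ | ⟨i, hf⟩)
    exacts [⟨s, Or.inl hs, hf⟩, ⟨_, Or.inr ⟨i, rfl⟩, hf⟩]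

end QuadsAttached

/-- Radial push of the points in the cells `quad (vert i)` away from the barycenters. -/
noncomputable def quadPush {t : ℕ} (vert : Fin t → Fin 4 → V) (c : ℝ) (f : V → ℝ) (v : V) : ℝ :=
  (f v - ∑ i, min (quadDepth (vert i) f) c * quadCenter (vert i) v) /
    (1 - ∑ i, min (quadDepth (vert i) f) c)

namespace QuadsAttached

variable {M : Set (Finset V)} {t : ℕ} {vert : Fin t → Fin 4 → V}

lemma quadPush_of_mem (h : QuadsAttached M vert) {f : V → ℝ} (hf : f ∈ realization M) {c : ℝ}
    (hc : 0 ≤ c) : quadPush vert c f = f := by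
  ext v
  simp [quadPush, h.depth_eq_zero_of_mem hf, hc]

lemma sum_depth_of_mem_cell (h : QuadsAttached M vert) {f : V → ℝ} {i : Fin t}
    (hf : f ∈ cell (quad (vert i))) : ∑ k, quadDepth (vert k) f = quadDepth (vert i) f :=
  sum_eq_single i (fun _ _ hk => h.depth_eq_zero_of_ne hf hk) (by simp)

lemma sum_min_of_mem_cell (h : QuadsAttached M vert) {f : V → ℝ} {i : Fin t}
    (hf : f ∈ cell (quad (vert i))) {c : ℝ} (hc : 0 ≤ c) :
    ∑ k, min (quadDepth (vert k) f) c = min (quadDepth (vert i) f) c :=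
  sum_eq_single i (fun _ _ hk => by rw [h.depth_eq_zero_of_ne hf hk, min_eq_left hc]) (by simp)

lemma quadPush_of_mem_cell (h : QuadsAttached M vert) {f : V → ℝ} {i : Fin t}
    (hf : f ∈ cell (quad (vert i))) {c : ℝ} (hc : 0 ≤ c) (v : V) :
    quadPush vert c f v = (f v - min (quadDepth (vert i) f) c * quadCenter (vert i) v) /
      (1 - min (quadDepth (vert i) f) c) := by
  rw [quadPush, h.sum_min_of_mem_cell hf hc,
    sum_eq_single i (fun k _ hk => by rw [h.depth_eq_zero_of_ne hf hk, min_eq_left hc, zero_mul])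
      (by simp)]

lemma quadPush_mem_cell (h : QuadsAttached M vert) {f : V → ℝ} {i : Fin t}
    (hf : f ∈ cell (quad (vert i))) {c : ℝ} (hc : 0 ≤ c) (hc' : c ≤ 1 / 2) :
    quadPush vert c f ∈ cell (quad (vert i)) := by
  have hle : min (quadDepth (vert i) f) c ≤ 1 / 2 := (min_le_right _ _).trans hc'
  have hle' : min (quadDepth (vert i) f) c ≤ quadDepth (vert i) f := min_le_left _ _
  generalize hν : min (quadDepth (vert i) f) c = ν at hle hle'
  have hpush : ∀ v, quadPush vert c f v = (f v - ν * quadCenter (vert i) v) / (1 - ν) :=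
    fun v => by rw [h.quadPush_of_mem_cell hf hc, hν]
  refine ⟨fun v => ?_, fun v hv => ?_, ?_⟩
  · rw [hpush]
    refine div_nonneg ?_ (by linarith)
    by_cases hv : v ∈ quad (vert i)
    · obtain ⟨j, -, rfl⟩ := mem_image.mp hv
      have := depth_le (fun j => f (vert i j)) j
      rw [quadDepth] at hle'
      rw [quadCenter, if_pos hv]
      linarith
    · rw [quadCenter, if_neg hv]
      simpa using hf.1 v
  · by_contra hv'
    refine hv ?_
    rw [hpush, quadCenter, if_neg hv', by_contra fun h => hv' (hf.2.1 v h)]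
    simp
  · have hb : ∑ v ∈ quad (vert i), quadCenter (vert i) v = 1 := by
      rw [sum_congr rfl fun v hv => show quadCenter (vert i) v = 1 / 4 from if_pos hv,
        sum_const, card_quad (h.inj i)]
      norm_num
    simp only [hpush]
    rw [← sum_div, sum_sub_distrib, ← mul_sum, hb, hf.2.2, mul_one]
    exact div_self (by linarith)

lemma quadPush_mem (h : QuadsAttached M vert) {f : V → ℝ}
    (hf : f ∈ realization (M ∪ Set.range fun i => quad (vert i))) {c : ℝ} (hc : 0 ≤ c)
    (hc' : c ≤ 1 / 2) :
    quadPush vert c f ∈ realization (M ∪ Set.range fun i => quad (vert i)) := by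
  rcases mem_union_iff.mp hf with hM | ⟨i, hi⟩
  · rwa [h.quadPush_of_mem hM hc]
  · exact mem_union_iff.mpr (Or.inr ⟨i, h.quadPush_mem_cell hi hc hc'⟩)

lemma quadPush_mem_base (h : QuadsAttached M vert) {f : V → ℝ}
    (hf : f ∈ realization (M ∪ Set.range fun i => quad (vert i))) {c : ℝ} (hc : 0 ≤ c)
    (hc' : c ≤ 1 / 2) (hd : ∑ i, quadDepth (vert i) f ≤ c) :
    quadPush vert c f ∈ realization M := by
  rcases mem_union_iff.mp hf with hM | ⟨i, hi⟩
  · rwa [h.quadPush_of_mem hM hc]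
  · rw [h.sum_depth_of_mem_cell hi] at hd
    obtain ⟨j, hj⟩ := exists_depth_eq fun j => f (vert i j)
    refine h.mem_of_apply_eq_zero (h.quadPush_mem_cell hi hc hc') (j := j) ?_
    rw [h.quadPush_of_mem_cell hi hc, min_eq_left hd, quadCenter, if_pos (mem_quad _ j), quadDepth,
      hj, show f (vert i j) - 4 * f (vert i j) * (1 / 4) = 0 by ring, zero_div]

lemma sum_depth_of_mem (h : QuadsAttached M vert) {f : V → ℝ} (hf : f ∈ realization M) :
    ∑ k, quadDepth (vert k) f = 0 :=
  sum_eq_zero fun k _ => h.depth_eq_zero_of_mem hf k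

lemma denominator_pos (h : QuadsAttached M vert) {f : V → ℝ}
    (hf : f ∈ realization (M ∪ Set.range fun i => quad (vert i))) {c : ℝ} (hc : 0 ≤ c)
    (hc' : c ≤ 1 / 2) : 0 < 1 - ∑ i, min (quadDepth (vert i) f) c := by
  rcases mem_union_iff.mp hf with hM | ⟨i, hi⟩
  · rw [sum_eq_zero fun k _ => by rw [h.depth_eq_zero_of_mem hM k, min_eq_left hc]]
    norm_num
  · rw [h.sum_min_of_mem_cell hi hc]
    linarith [min_le_right (quadDepth (vert i) f) c]

lemma quadPush_zero {f : V → ℝ}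
    (hf : f ∈ realization (M ∪ Set.range fun i => quad (vert i))) : quadPush vert 0 f = f := by
  have : ∀ i, min (quadDepth (vert i) f) 0 = 0 := fun i => by
    obtain ⟨s, -, hs⟩ := hf
    exact min_eq_right (depth_nonneg fun j => hs.1 _)
  ext v
  simp [quadPush, this]

end QuadsAttached

end TopCells

section QuadQuotient

variable {V : Type} [DecidableEq V]

namespace QuadsAttached

variable {M : Set (Finset V)} {t : ℕ} {vert : Fin t → Fin 4 → V}

/-- A deformation of the complex obtained by attaching cells to `M` that restricts to a given
contraction of `M`. -/
lemma exists_deformation (h : QuadsAttached M vert) {x : V → ℝ} (hx : x ∈ realization M)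
    (H : C(unitInterval × realization M, realization M)) (H0 : ∀ f, H (0, f) = f)
    (H1 : ∀ f, H (1, f) = ⟨x, hx⟩) (Hx : ∀ s, H (s, ⟨x, hx⟩) = ⟨x, hx⟩)
    (hxK : x ∈ realization (M ∪ Set.range fun i => quad (vert i))) :
    ∃ G : C(unitInterval × realization (M ∪ Set.range fun i => quad (vert i)),
        realization (M ∪ Set.range fun i => quad (vert i))),
      (∀ f, G (0, f) = f) ∧ (∀ s f, f.1 ∈ realization M → (G (s, f)).1 ∈ realization M) ∧
      (∀ f, f.1 ∈ realization M → G (1, f) = ⟨x, hxK⟩) ∧ ∀ s, G (s, ⟨x, hxK⟩) = ⟨x, hxK⟩ := by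
  set K := M ∪ Set.range fun i => quad (vert i) with hK
  have half0 : ∀ s : unitInterval, 0 ≤ (s : ℝ) / 2 := fun s => by linarith [s.2.1]
  have half1 : ∀ s : unitInterval, (s : ℝ) / 2 ≤ 1 / 2 := fun s => by linarith [s.2.2]
  have hMK : realization M ⊆ realization K := realization_mono Set.subset_union_left
  let S : (V → ℝ) → ℝ := fun f => ∑ i, quadDepth (vert i) f
  have hS : Continuous S := continuous_finsetSum _ fun i _ => continuous_quadDepth _
  let P : unitInterval × realization K → V → ℝ := fun p => quadPush vert (p.1 / 2) p.2.1
  have hP : Continuous P := by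
    refine continuous_pi fun v => ?_
    have hmin : ∀ i, Continuous fun p : unitInterval × realization K =>
        min (quadDepth (vert i) p.2.1) ((p.1 : ℝ) / 2) := fun i =>
      ((continuous_quadDepth _).comp (continuous_subtype_val.comp continuous_snd)).min (by fun_prop)
    refine Continuous.div ?_ ?_ fun p => (h.denominator_pos p.2.2 (half0 _) (half1 _)).ne'
    · exact ((continuous_apply v).comp (continuous_subtype_val.comp continuous_snd)).sub
        (continuous_finsetSum _ fun i _ => (hmin i).mul continuous_const)
    · exact continuous_const.sub (continuous_finsetSum _ fun i _ => hmin i)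
  have hPK : ∀ p, P p ∈ realization K := fun p => h.quadPush_mem p.2.2 (half0 _) (half1 _)
  let D₁ : Set (unitInterval × realization K) := {p | S p.2.1 ≤ p.1 / 2}
  let D₂ : Set (unitInterval × realization K) := {p | p.1 / 2 ≤ S p.2.1}
  have hSc : Continuous fun p : unitInterval × realization K => S p.2.1 :=
    hS.comp (continuous_subtype_val.comp continuous_snd)
  have hhc : Continuous fun p : unitInterval × realization K => (p.1 : ℝ) / 2 := by fun_prop
  have hD₁ : IsClosed D₁ := isClosed_le hSc hhc
  have hD₂ : IsClosed D₂ := isClosed_le hhc hSc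
  have hPM : ∀ p ∈ D₁, P p ∈ realization M := fun p hp =>
    h.quadPush_mem_base p.2.2 (half0 _) (half1 _) hp
  let time : unitInterval × realization K → unitInterval := fun p =>
    Set.projIcc 0 1 zero_le_one ((p.1 : ℝ) - 2 * S p.2.1)
  have htime : Continuous time := continuous_projIcc.comp (by fun_prop)
  classical
  let F : unitInterval × realization K → V → ℝ := fun p =>
    if hp : p ∈ D₁ then (H (time p, ⟨P p, hPM p hp⟩)).1 else P p
  have hF₁ : ContinuousOn F D₁ := by
    rw [continuousOn_iff_continuous_domRestrict]
    have : D₁.domRestrict F = fun p => (H (time p.1, ⟨P p.1, hPM p.1 p.2⟩)).1 :=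
      funext fun p => dif_pos p.2
    rw [this]
    exact continuous_subtype_val.comp (H.continuous.comp
      ((htime.comp continuous_subtype_val).prodMk
        ((hP.comp continuous_subtype_val).subtype_mk _)))
  have hF₂ : ContinuousOn F D₂ := by
    refine hP.continuousOn.congr fun p hp => ?_
    by_cases hp' : p ∈ D₁
    · have h0 : time p = 0 := by
        have : (p.1 : ℝ) - 2 * S p.2.1 = 0 := by
          have h1 : S p.2.1 ≤ p.1 / 2 := hp'
          have h2 : (p.1 : ℝ) / 2 ≤ S p.2.1 := hp
          linarith
        simp only [time, this]
        exact Set.projIcc_left _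
      simp only [F, dif_pos hp', h0, H0]
    · exact dif_neg hp'
  have hF : Continuous F := by
    rw [← continuousOn_univ]
    refine (hF₁.union_of_isClosed hF₂ hD₁ hD₂).mono fun p _ => ?_
    exact le_total (S p.2.1) (p.1 / 2)
  have hFK : ∀ p, F p ∈ realization K := by
    intro p
    by_cases hp : p ∈ D₁
    · simp only [F, dif_pos hp]
      exact hMK (Subtype.property _)
    · simp only [F, dif_neg hp]
      exact hPK p
  have hFM : ∀ (s : unitInterval) (f : realization K) (hf : f.1 ∈ realization M),
      F (s, f) = (H (s, ⟨f.1, hf⟩)).1 := by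
    intro s f hf
    have hs0 : S f.1 = 0 := h.sum_depth_of_mem hf
    have hp : (s, f) ∈ D₁ := by
      show S f.1 ≤ s / 2
      rw [hs0]
      exact half0 s
    have h1 : time (s, f) = s := by
      simp only [time, hs0, mul_zero, sub_zero]
      exact Set.projIcc_val _ s
    have h2 : P (s, f) = f.1 := h.quadPush_of_mem hf (half0 s)
    simp only [F, dif_pos hp, h1, h2]
  refine ⟨⟨fun p => ⟨F p, hFK p⟩, hF.subtype_mk _⟩, fun f => Subtype.ext ?_, fun s f hf => ?_,
    fun f hf => Subtype.ext ?_, fun s => Subtype.ext ?_⟩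
  · have h2 : P (0, f) = f.1 := by
      simp only [P, Set.Icc.coe_zero, zero_div]
      exact quadPush_zero f.2
    show F (0, f) = f.1
    by_cases hp : (0, f) ∈ D₁
    · have hM : f.1 ∈ realization M := h2 ▸ hPM _ hp
      rw [hFM 0 f hM, H0]
    · simp only [F, dif_neg hp, h2]
  · show F (s, f) ∈ _
    rw [hFM s f hf]
    exact Subtype.property _
  · show F (1, f) = x
    rw [hFM 1 f hf, H1]
  · show F (s, ⟨x, hxK⟩) = x
    rw [hFM s _ hx, Hx]

end QuadsAttached

end QuadQuotient

section WedgeSphere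

/-- The inclusion of a summand of a wedge. -/
def wedgeIn {c : ℕ} {X : Type} [TopologicalSpace X] (x₀ : X) (i : Fin c) (x : X) : Wedge c X x₀ :=
  Quot.mk _ (Sum.inr (i, x))

lemma continuous_wedgeIn {c : ℕ} {X : Type} [TopologicalSpace X] (x₀ : X) (i : Fin c) :
    Continuous (wedgeIn x₀ i) :=
  continuous_quot_mk.comp (continuous_inr.comp (continuous_const.prodMk continuous_id))

lemma wedgeIn_base {c : ℕ} {X : Type} [TopologicalSpace X] (x₀ : X) (i : Fin c) :
    wedgeIn x₀ i x₀ = wedgePt c X x₀ :=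
  (Quot.sound (wedgeRel.glue i)).symm

/-- The canonical map from a wedge to a product. -/
noncomputable def wedgeToPi (c : ℕ) (X : Type) [TopologicalSpace X] (x₀ : X) :
    Wedge c X x₀ → Fin c → X :=
  Quot.lift (Sum.elim (fun _ _ => x₀) fun p => Function.update (fun _ => x₀) p.1 p.2) (by
    rintro _ _ ⟨i⟩
    exact (Function.update_eq_self i fun _ => x₀).symm)

lemma continuous_wedgeToPi (c : ℕ) (X : Type) [TopologicalSpace X] (x₀ : X) :
    Continuous (wedgeToPi c X x₀) := by
  refine continuous_quot_lift _ (continuous_sum_dom.mpr ⟨continuous_const, ?_⟩)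
  show Continuous fun p : Fin c × X => Function.update (fun _ => x₀) p.1 p.2
  refine continuous_pi fun k => ?_
  refine continuous_prod_of_discrete_left.mpr fun i => ?_
  have : Continuous fun x : X => Function.update (fun _ : Fin c => x₀) i x :=
    continuous_const.update i continuous_id
  exact (continuous_apply k).comp this

lemma wedgeToPi_wedgeIn (c : ℕ) (X : Type) [TopologicalSpace X] (x₀ : X) (i : Fin c) (x : X) :
    wedgeToPi c X x₀ (wedgeIn x₀ i x) = Function.update (fun _ => x₀) i x := rfl

lemma wedgeIn_eq_base_iff {c : ℕ} {X : Type} [TopologicalSpace X] {x₀ : X} {i : Fin c} {x : X} :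
    wedgeIn x₀ i x = wedgePt c X x₀ ↔ x = x₀ := by
  constructor
  · intro h
    have := congrFun (congrArg (wedgeToPi c X x₀) h) i
    rwa [wedgeToPi_wedgeIn, Function.update_self] at this
  · rintro rfl
    exact wedgeIn_base x i

lemma wedgeIn_eq_wedgeIn {c : ℕ} {X : Type} [TopologicalSpace X] {x₀ : X} {i j : Fin c} {x y : X}
    (h : wedgeIn x₀ i x = wedgeIn x₀ j y) :
    i = j ∧ x = y ∨ x = x₀ ∧ y = x₀ := by
  have h' := congrArg (wedgeToPi c X x₀) h
  rw [wedgeToPi_wedgeIn, wedgeToPi_wedgeIn] at h'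
  by_cases hij : i = j
  · subst hij
    have := congrFun h' i
    rw [Function.update_self, Function.update_self] at this
    exact Or.inl ⟨rfl, this⟩
  · have h1 := congrFun h' i
    have h2 := congrFun h' j
    rw [Function.update_self, Function.update_of_ne hij] at h1
    rw [Function.update_self, Function.update_of_ne (Ne.symm hij)] at h2
    exact Or.inr ⟨h1, h2.symm⟩

lemma wedge_cases {c : ℕ} {X : Type} [TopologicalSpace X] {x₀ : X} (w : Wedge c X x₀) :
    w = wedgePt c X x₀ ∨ ∃ i x, w = wedgeIn x₀ i x := by
  induction w using Quot.ind with
  | mk a =>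
    rcases a with u | ⟨i, x⟩
    · exact Or.inl rfl
    · exact Or.inr ⟨i, x, rfl⟩

instance (c : ℕ) (X : Type) [TopologicalSpace X] [T2Space X] (x₀ : X) :
    T2Space (Wedge c X x₀) := by
  refine .of_injective_continuous (f := wedgeToPi c X x₀) ?_ (continuous_wedgeToPi c X x₀)
  have hpt : wedgeToPi c X x₀ (wedgePt c X x₀) = fun _ => x₀ := rfl
  intro a b hab
  rcases wedge_cases a with rfl | ⟨i, x, rfl⟩ <;> rcases wedge_cases b with rfl | ⟨j, y, rfl⟩
  · rfl
  · rw [hpt, wedgeToPi_wedgeIn] at hab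
    have := congrFun hab j
    rw [Function.update_self] at this
    rw [← this, wedgeIn_base]
  · rw [hpt, wedgeToPi_wedgeIn] at hab
    have := congrFun hab i
    rw [Function.update_self] at this
    rw [this, wedgeIn_base]
  · rw [wedgeToPi_wedgeIn, wedgeToPi_wedgeIn] at hab
    by_cases hij : i = j
    · subst hij
      have := congrFun hab i
      rw [Function.update_self, Function.update_self] at this
      rw [this]
    · have h1 := congrFun hab i
      have h2 := congrFun hab j
      rw [Function.update_self, Function.update_of_ne hij] at h1
      rw [Function.update_self, Function.update_of_ne (Ne.symm hij)] at h2
      rw [h1, ← h2, wedgeIn_base, wedgeIn_base]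

end WedgeSphere

lemma simplexToSphere_eq_base_iff {a : stdSimplex ℝ (Fin 4)} :
    simplexToSphere a = sphBase 3 ↔ depth a.1 = 0 := by
  refine ⟨fun h => ?_, simplexToSphere_of_depth_eq_zero⟩
  have hv : depth (Pi.single 0 1 : Fin 4 → ℝ) = 0 := by
    refine le_antisymm ?_ (depth_nonneg (single_mem_stdSimplex ℝ (0 : Fin 4)).1)
    simpa using depth_le (Pi.single 0 1 : Fin 4 → ℝ) 1
  rw [← simplexToSphere_of_depth_eq_zero (a := ⟨_, single_mem_stdSimplex ℝ 0⟩) hv] at h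
  rcases simplexToSphere_injective h with rfl | ⟨h0, -⟩
  exacts [hv, h0]

section QuadQuotient

variable {V : Type} [DecidableEq V]

namespace QuadsAttached

variable {M : Set (Finset V)} {t : ℕ} {vert : Fin t → Fin 4 → V}

/-- The map from an attached cell to the sphere. -/
noncomputable def chart (h : QuadsAttached M vert) {i : Fin t} {f : V → ℝ}
    (hf : f ∈ cell (quad (vert i))) : Sph 3 :=
  simplexToSphere ⟨fun j => f (vert i j), mem_stdSimplex_of_mem_cell (h.inj i) hf⟩

lemma chart_of_mem (h : QuadsAttached M vert) {i : Fin t} {f : V → ℝ}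
    (hf : f ∈ cell (quad (vert i))) (hfM : f ∈ realization M) : h.chart hf = sphBase 3 :=
  simplexToSphere_of_depth_eq_zero (h.depth_eq_zero_of_mem hfM i)

lemma chart_eq_base_iff (h : QuadsAttached M vert) {i : Fin t} {f : V → ℝ}
    (hf : f ∈ cell (quad (vert i))) : h.chart hf = sphBase 3 ↔ f ∈ realization M :=
  ⟨fun hc => h.mem_of_depth_eq_zero hf (simplexToSphere_eq_base_iff.mp hc), h.chart_of_mem hf⟩

/-- The map collapsing `M` to a point. -/
noncomputable def collapse (h : QuadsAttached M vert) (f : V → ℝ) : WedgeSph 3 t :=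
  open Classical in
  if hf : ∃ i, f ∈ cell (quad (vert i)) then
    wedgeIn _ hf.choose (h.chart hf.choose_spec)
  else wedgePt t _ _

lemma collapse_of_mem (h : QuadsAttached M vert) {f : V → ℝ} (hf : f ∈ realization M) :
    h.collapse f = wedgePt t _ _ := by
  rw [collapse]
  split_ifs with hc
  · rw [h.chart_of_mem _ hf, wedgeIn_base]
  · rfl

lemma collapse_of_mem_cell (h : QuadsAttached M vert) {f : V → ℝ} {i : Fin t}
    (hf : f ∈ cell (quad (vert i))) : h.collapse f = wedgeIn _ i (h.chart hf) := by
  by_cases hfM : f ∈ realization M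
  · rw [h.collapse_of_mem hfM, h.chart_of_mem _ hfM,
      wedgeIn_base]
  · have hc : ∃ i, f ∈ cell (quad (vert i)) := ⟨i, hf⟩
    rw [collapse, dif_pos hc]
    have : i = hc.choose := by
      by_contra hne
      exact hfM (h.mem_of_depth_eq_zero hf (h.depth_eq_zero_of_ne hc.choose_spec hne))
    have key : ∀ (k : Fin t) (hk : f ∈ cell (quad (vert k))), i = k →
        wedgeIn (sphBase 3) k (h.chart hk) =
        wedgeIn _ i (h.chart hf) := by
      rintro k hk rfl
      rfl
    exact key _ hc.choose_spec this

lemma continuous_collapse (h : QuadsAttached M vert) :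
    Continuous fun f : realization (M ∪ Set.range fun i => quad (vert i)) => h.collapse f.1 := by
  let S : Option (Fin t) → Set (realization (M ∪ Set.range fun i => quad (vert i))) := fun o =>
    Subtype.val ⁻¹' o.elim (realization M) fun i => cell (quad (vert i))
  refine (locallyFinite_of_finite S).continuous ?_ ?_ ?_
  · refine Set.eq_univ_of_forall fun f => Set.mem_iUnion.mpr ?_
    rcases mem_union_iff.mp f.2 with hM | ⟨i, hi⟩
    exacts [⟨none, hM⟩, ⟨some i, hi⟩]
  · rintro (_ | i)
    · exact (isCompact_realization h.finite).isClosed.preimage continuous_subtype_val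
    · exact (isClosed_cell _).preimage continuous_subtype_val
  · rintro (_ | i)
    · exact continuousOn_const.congr fun f hf => h.collapse_of_mem hf
    · rw [continuousOn_iff_continuous_domRestrict]
      have : (S (some i)).domRestrict (fun f => h.collapse f.1) = fun f =>
          wedgeIn _ i (h.chart f.2) :=
        funext fun f => h.collapse_of_mem_cell f.2
      rw [this]
      refine (continuous_wedgeIn _ i).comp (continuous_simplexToSphere.comp ?_)
      have hj : ∀ j, Continuous fun f : S (some i) => f.1.1 (vert i j) := fun j =>
        (continuous_apply (vert i j)).comp (continuous_subtype_val.comp continuous_subtype_val)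
      exact (continuous_pi hj).subtype_mk _

lemma exists_preimage (h : QuadsAttached M vert) (i : Fin t) (x : Sph 3) :
    ∃ f ∈ cell (quad (vert i)), h.collapse f = wedgeIn _ i x := by
  obtain ⟨a, rfl⟩ := simplexToSphere_surjective x
  obtain ⟨f, hf, hfa⟩ := exists_mem_cell_quad (h.inj i) a.2
  refine ⟨f, hf, ?_⟩
  have : h.chart hf = simplexToSphere a := congrArg simplexToSphere (Subtype.ext (funext hfa))
  rw [h.collapse_of_mem_cell hf, this]

lemma collapse_eq_base_iff (h : QuadsAttached M vert) {f : V → ℝ}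
    (hf : f ∈ realization (M ∪ Set.range fun i => quad (vert i))) :
    h.collapse f = wedgePt t _ _ ↔ f ∈ realization M := by
  refine ⟨fun hc => ?_, h.collapse_of_mem⟩
  rcases mem_union_iff.mp hf with hM | ⟨i, hi⟩
  · exact hM
  · rw [h.collapse_of_mem_cell hi, wedgeIn_eq_base_iff] at hc
    exact (h.chart_eq_base_iff hi).mp hc

lemma collapse_eq_iff (h : QuadsAttached M vert) {f g : V → ℝ}
    (hf : f ∈ realization (M ∪ Set.range fun i => quad (vert i)))
    (hg : g ∈ realization (M ∪ Set.range fun i => quad (vert i))) :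
    h.collapse f = h.collapse g ↔ f = g ∨ f ∈ realization M ∧ g ∈ realization M := by
  constructor
  · intro hc
    by_cases hfM : f ∈ realization M
    · rw [h.collapse_of_mem hfM, eq_comm, h.collapse_eq_base_iff hg] at hc
      exact Or.inr ⟨hfM, hc⟩
    by_cases hgM : g ∈ realization M
    · rw [h.collapse_of_mem hgM, h.collapse_eq_base_iff hf] at hc
      exact absurd hc hfM
    obtain ⟨i, hi⟩ := (mem_union_iff.mp hf).resolve_left hfM
    obtain ⟨j, hj⟩ := (mem_union_iff.mp hg).resolve_left hgM
    rw [h.collapse_of_mem_cell hi, h.collapse_of_mem_cell hj] at hc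
    rcases wedgeIn_eq_wedgeIn hc with ⟨rfl, he⟩ | ⟨he, -⟩
    · rcases simplexToSphere_injective he with he | ⟨he, -⟩
      · exact Or.inl (eq_of_mem_cell_quad hi hj fun k => congrFun (Subtype.ext_iff.mp he) k)
      · exact absurd (h.mem_of_depth_eq_zero hi he) hfM
    · exact absurd ((h.chart_eq_base_iff hi).mp he) hfM
  · rintro (rfl | ⟨hfM, hgM⟩)
    · rfl
    · rw [h.collapse_of_mem hfM, h.collapse_of_mem hgM]

lemma pHEq (h : QuadsAttached M vert) {x : V → ℝ} (hx : x ∈ realization M)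
    (H : C(unitInterval × realization M, realization M)) (H0 : ∀ f, H (0, f) = f)
    (H1 : ∀ f, H (1, f) = ⟨x, hx⟩) (Hx : ∀ s, H (s, ⟨x, hx⟩) = ⟨x, hx⟩)
    (hxK : x ∈ realization (M ∪ Set.range fun i => quad (vert i))) :
    PHEq (realization (M ∪ Set.range fun i => quad (vert i))) (WedgeSph 3 t) ⟨x, hxK⟩
      (wedgeSphPt 3 t) := by
  obtain ⟨G, G0, GM, G1, Gx⟩ := h.exists_deformation hx H H0 H1 Hx hxK
  have : CompactSpace (realization (M ∪ Set.range fun i => quad (vert i))) :=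
    isCompact_iff_compactSpace.mp (isCompact_realization (h.finite.union (Set.finite_range _)))
  have hq : h.collapse x = wedgeSphPt 3 t := h.collapse_of_mem hx
  rw [← hq]
  refine PHEq.of_collapse ⟨_, h.continuous_collapse⟩ ?_ (A := {f | f.1 ∈ realization M})
    (x₀ := ⟨x, hxK⟩) ?_ G G0 GM G1 Gx
  · intro w
    rcases wedge_cases w with rfl | ⟨i, y, rfl⟩
    · exact ⟨⟨x, hxK⟩, hq⟩
    · obtain ⟨f, hf, hfy⟩ := h.exists_preimage i y
      exact ⟨⟨f, mem_union_iff.mpr (Or.inr ⟨i, hf⟩)⟩, hfy⟩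
  · intro a b
    exact (h.collapse_eq_iff a.2 b.2).trans (or_congr_left Subtype.ext_iff.symm)

end QuadsAttached

/-- A complex built from a point by elementary expansions and by attaching `t` tetrahedra along
their boundaries is a wedge of `t` spheres. -/
lemma Built.pHEq_wedge {t : ℕ} {p : V} {X : Set (Finset V)} (h : Built 4 {∅, {p}} t X)
    (hp : {p} ∈ X) :
    PHEq (realization X) (WedgeSph 3 t) ⟨_, single_mem_realization hp⟩ (wedgeSphPt 3 t) := by
  have hlow : IsLowerSet ({∅, {p}} : Set (Finset V)) := by
    rintro a b hb (rfl | rfl)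
    · exact Or.inl (subset_empty.mp hb)
    · exact (subset_singleton_iff.mp hb)
  obtain ⟨M, T, hT, hM, hTM, hX, -⟩ := h.exists_reorder
  have hpM : {p} ∈ M := hM.subset (by simp)
  have h0M : ∅ ∈ M := hM.subset (by simp)
  have hMlow := hM.isLowerSet hlow
  let e : Fin t ≃ T := (T.equivFinOfCardEq hT).symm
  have hcard : ∀ i, (e i).1.card = 4 := fun i => (hTM _ (e i).2).2.1
  let vert : Fin t → Fin 4 → V := fun i j => ((e i).1.equivFinOfCardEq (hcard i)).symm j
  have hquad : ∀ i, quad (vert i) = (e i).1 := by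
    intro i
    ext v
    simp only [quad, mem_image, mem_univ, true_and]
    constructor
    · rintro ⟨j, rfl⟩
      exact Subtype.property _
    · intro hv
      exact ⟨(e i).1.equivFinOfCardEq (hcard i) ⟨v, hv⟩, by simp [vert]⟩
  have hrange : (Set.range fun i => quad (vert i)) = (T : Set (Finset V)) := by
    ext s
    simp only [hquad, Set.mem_range, mem_coe]
    constructor
    · rintro ⟨i, rfl⟩
      exact (e i).2
    · intro hs
      exact ⟨e.symm ⟨s, hs⟩, by simp⟩
  have hQ : QuadsAttached M vert :=
    { lower := hMlow
      finite := hM.finite (Set.toFinite _)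
      inj := fun i => Subtype.val_injective.comp (Equiv.injective _)
      notMem := fun i => by rw [hquad]; exact (hTM _ (e i).2).1
      boundary := fun i => by rw [hquad]; exact (hTM _ (e i).2).2.2
      distinct := fun i j hij => by
        simp only [hquad] at hij
        exact e.injective (Subtype.ext hij) }
  have hpK : {p} ∈ M ∪ (T : Set (Finset V)) := Or.inl hpM
  obtain ⟨H, H0, H1, Hx⟩ := hM.exists_contraction hpM
  have hKlow : IsLowerSet (M ∪ (T : Set (Finset V))) := by
    rintro a b hb (ha | ha)
    · exact Or.inl (hMlow hb ha)
    · by_cases hab : b = a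
      · exact Or.inr (hab ▸ ha)
      · exact Or.inl ((hTM a ha).2.2 b (hb.lt_of_ne hab))
  refine (hX.pHEq hKlow (Or.inl h0M) hpK hp).symm.trans ?_
  have := hQ.pHEq (single_mem_realization hpM) H H0 H1 Hx
  rw [hrange] at this
  exact this (single_mem_realization hpK)

end QuadQuotient

section WedgeMaps

variable {W X Y Z : Type} [TopologicalSpace W] [TopologicalSpace X] [TopologicalSpace Y]
  [TopologicalSpace Z]

/-- The map out of a wedge determined by maps on the summands. -/
def wedgeDesc {c : ℕ} {x₀ : X} (f : Fin c → C(X, Y)) (y : Y) (hf : ∀ i, f i x₀ = y) :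
    C(Wedge c X x₀, Y) where
  toFun := Quot.lift (Sum.elim (fun _ => y) fun p => f p.1 p.2) (by
    rintro _ _ ⟨i⟩
    exact (hf i).symm)
  continuous_toFun := continuous_quot_lift _ (continuous_sum_dom.mpr ⟨continuous_const,
    continuous_prod_of_discrete_left.mpr fun i => (f i).continuous⟩)

lemma wedgeDesc_wedgeIn {c : ℕ} {x₀ : X} (f : Fin c → C(X, Y)) (y : Y) (hf : ∀ i, f i x₀ = y)
    (i : Fin c) (x : X) : wedgeDesc f y hf (wedgeIn x₀ i x) = f i x := rfl

/-- The inclusion of the left summand of a binary wedge. -/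
def wedgeInl (x : X) (y : Y) : C(X, Wedge2 X Y x y) :=
  ⟨fun a => Quot.mk _ (Sum.inl a), continuous_quot_mk.comp continuous_inl⟩

/-- The inclusion of the right summand of a binary wedge. -/
def wedgeInr (x : X) (y : Y) : C(Y, Wedge2 X Y x y) :=
  ⟨fun a => Quot.mk _ (Sum.inr a), continuous_quot_mk.comp continuous_inr⟩

lemma wedgeInl_base (x : X) (y : Y) : wedgeInl x y x = wedgeInr x y y :=
  Quot.sound wedge2Rel.glue

/-- The map out of a binary wedge determined by maps on the summands. -/
def wedge2Desc {x : X} {y : Y} (f : C(X, Z)) (g : C(Y, Z)) (h : f x = g y) :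
    C(Wedge2 X Y x y, Z) where
  toFun := Quot.lift (Sum.elim f g) (by
    rintro _ _ ⟨⟩
    exact h)
  continuous_toFun := continuous_quot_lift _ (continuous_sum_dom.mpr ⟨f.continuous, g.continuous⟩)

lemma wedge2_cases {x : X} {y : Y} (w : Wedge2 X Y x y) :
    (∃ a, w = wedgeInl x y a) ∨ ∃ b, w = wedgeInr x y b := by
  induction w using Quot.ind with
  | mk a =>
    rcases a with a | b
    exacts [Or.inl ⟨a, rfl⟩, Or.inr ⟨b, rfl⟩]

/-- A wedge of `s + t` summands is the binary wedge of a wedge of `s` and a wedge of `t`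
summands. -/
def wedgeAddHomeomorph (s t : ℕ) (x₀ : X) :
    Wedge (s + t) X x₀ ≃ₜ Wedge2 (Wedge s X x₀) (Wedge t X x₀) (wedgePt s X x₀) (wedgePt t X x₀) :=
  let f : C(Wedge (s + t) X x₀,
      Wedge2 (Wedge s X x₀) (Wedge t X x₀) (wedgePt s X x₀) (wedgePt t X x₀)) :=
    wedgeDesc (Fin.addCases
      (fun i => (wedgeInl _ _).comp ⟨wedgeIn x₀ i, continuous_wedgeIn x₀ i⟩)
      (fun j => (wedgeInr _ _).comp ⟨wedgeIn x₀ j, continuous_wedgeIn x₀ j⟩))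
      (wedgeInl _ _ (wedgePt s X x₀)) (fun i => by
        refine Fin.addCases (fun i => ?_) (fun j => ?_) i
        · rw [Fin.addCases_left, ContinuousMap.comp_apply]
          exact congrArg _ (wedgeIn_base x₀ i)
        · rw [Fin.addCases_right, ContinuousMap.comp_apply, wedgeInl_base]
          exact congrArg _ (wedgeIn_base x₀ j))
  let g : C(Wedge2 (Wedge s X x₀) (Wedge t X x₀) (wedgePt s X x₀) (wedgePt t X x₀),
      Wedge (s + t) X x₀) :=
    wedge2Desc
      (wedgeDesc (fun i => ⟨wedgeIn x₀ (Fin.castAdd t i), continuous_wedgeIn x₀ _⟩)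
        (wedgePt (s + t) X x₀) fun i => wedgeIn_base x₀ _)
      (wedgeDesc (fun i => ⟨wedgeIn x₀ (Fin.natAdd s i), continuous_wedgeIn x₀ _⟩)
        (wedgePt (s + t) X x₀) fun i => wedgeIn_base x₀ _) rfl
  have hfl : ∀ i x, f (wedgeIn x₀ (Fin.castAdd t i) x) = wedgeInl _ _ (wedgeIn x₀ i x) :=
    fun i x => by
      simp only [f, wedgeDesc_wedgeIn, Fin.addCases_left]
      rfl
  have hfr : ∀ i x, f (wedgeIn x₀ (Fin.natAdd s i) x) = wedgeInr _ _ (wedgeIn x₀ i x) :=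
    fun i x => by
      simp only [f, wedgeDesc_wedgeIn, Fin.addCases_right]
      rfl
  { toFun := f
    invFun := g
    left_inv := fun w => by
      rcases wedge_cases w with rfl | ⟨i, x, rfl⟩
      · rfl
      · refine Fin.addCases (fun i => ?_) (fun j => ?_) i
        · rw [hfl]; rfl
        · rw [hfr]; rfl
    right_inv := fun w => by
      rcases wedge2_cases w with ⟨w, rfl⟩ | ⟨w, rfl⟩ <;> rcases wedge_cases w with rfl | ⟨i, x, rfl⟩
      · rfl
      · exact hfl i x
      · exact wedgeInl_base _ _
      · exact hfr i x
    continuous_toFun := f.continuous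
    continuous_invFun := g.continuous }

/-- The self-map of a wedge functor in its right summand. -/
def wedge2Map (z : Z) {x : X} {y : Y} (f : C(X, Y)) (hf : f x = y) :
    C(Wedge2 Z X z x, Wedge2 Z Y z y) :=
  wedge2Desc (wedgeInl z y) ((wedgeInr z y).comp f)
    (by rw [ContinuousMap.comp_apply, hf, wedgeInl_base])

lemma wedge2Map_id (z : Z) (x : X) : wedge2Map z (.id X) rfl = .id (Wedge2 Z X z x) := by
  ext w
  rcases wedge2_cases w with ⟨w, rfl⟩ | ⟨w, rfl⟩ <;> rfl

lemma wedge2Map_comp (z : Z) {w : W} {x : X} {y : Y} (f : C(W, X)) (g : C(X, Y)) (hf : f w = x)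
    (hg : g x = y) : (wedge2Map z g hg).comp (wedge2Map z f hf) =
      wedge2Map z (g.comp f) (by rw [ContinuousMap.comp_apply, hf, hg]) := by
  ext w
  rcases wedge2_cases w with ⟨w, rfl⟩ | ⟨w, rfl⟩ <;> rfl

lemma HomotopicRel.wedge2Map (z : Z) {x : X} {y : Y} {f g : C(X, Y)} (h : f.HomotopicRel g {x})
    (hf : f x = y) (hg : g x = y) :
    (wedge2Map z f hf).HomotopicRel (wedge2Map z g hg) {wedgeInl z x z} := by
  obtain ⟨H, H0, H1, Hx⟩ := HomotopicRel.exists_homotopy h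
  let L : C(Z, C(unitInterval, Wedge2 Z Y z y)) :=
    ContinuousMap.curry ((wedgeInl z y).comp ⟨Prod.fst, continuous_fst⟩)
  let R : C(X, C(unitInterval, Wedge2 Z Y z y)) :=
    ContinuousMap.curry ((wedgeInr z y).comp (H.comp ⟨Prod.swap, continuous_swap⟩))
  have hLR : L z = R x := by
    ext t
    show wedgeInl z y z = wedgeInr z y (H (t, x))
    rw [Hx, hf, wedgeInl_base]
  let K := (wedge2Desc L R hLR).uncurry.comp ⟨Prod.swap, continuous_swap⟩
  refine homotopicRel_singleton_of_eq K ?_ ?_ ?_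
  · intro w
    rcases wedge2_cases w with ⟨w, rfl⟩ | ⟨w, rfl⟩
    · rfl
    · exact congrArg (wedgeInr z y) (H0 w)
  · intro w
    rcases wedge2_cases w with ⟨w, rfl⟩ | ⟨w, rfl⟩
    · rfl
    · exact congrArg (wedgeInr z y) (H1 w)
  · intro t
    rfl

lemma PHEq.wedge2 (z : Z) {x : X} {y : Y} (h : PHEq X Y x y) :
    PHEq (Wedge2 Z X z x) (Wedge2 Z Y z y) (wedgeInl z x z) (wedgeInl z y z) := by
  obtain ⟨f, g, hf, hg, h1, h2⟩ := h
  refine ⟨wedge2Map z f hf, wedge2Map z g hg, rfl, rfl, ?_, ?_⟩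
  · rw [wedge2Map_comp, ← wedge2Map_id]
    exact HomotopicRel.wedge2Map z h1 _ _
  · rw [wedge2Map_comp, ← wedge2Map_id]
    exact HomotopicRel.wedge2Map z h2 _ _

end WedgeMaps

section Final

lemma realization_vrCells (F : Set (Finset ℕ)) :
    realization (vrCells F) = {f | (∀ v, 0 ≤ f v) ∧
      ∃ s ∈ (VRc F 2).faces, (∀ v, f v ≠ 0 → v ∈ s) ∧ ∑ v ∈ s, f v = 1} := by
  ext f
  constructor
  · rintro ⟨s, hs, hf⟩
    refine ⟨hf.1, s, ⟨?_, hs⟩, hf.2⟩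
    rw [nonempty_iff_ne_empty]
    rintro rfl
    simpa using hf.2.2
  · rintro ⟨h0, s, hs, hf⟩
    exact ⟨s, hs.2, h0, hf⟩

/-- The realization of a Vietoris–Rips complex, as a union of closed simplices. -/
def spaceHomeomorph (F : Set (Finset ℕ)) : realization (vrCells F) ≃ₜ (VRc F 2).space :=
  Homeomorph.setCongr (realization_vrCells F)

lemma singleton_mem_vrCells_Fle (m n : ℕ) : {∅} ∈ vrCells (Fle m n) :=
  (built_vrCells_Fle m n).subset (by simp)

/-- The vertex `∅` of the Vietoris–Rips complex. -/
noncomputable def emptyVertex (m n : ℕ) : (VRc (Fle m n) 2).space :=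
  spaceHomeomorph _ ⟨_, single_mem_realization (singleton_mem_vrCells_Fle m n)⟩

lemma pHEq_space_wedge (m n : ℕ) (hn : 2 ≤ n) :
    PHEq (VRc (Fle m n) 2).space (WedgeSph 3 (∑ k ∈ Icc 3 n, tN m k)) (emptyVertex m n)
      (wedgeSphPt 3 _) := by
  rw [← sum_rA_eq_sum_tN m n hn]
  exact (PHEq.of_homeomorph (spaceHomeomorph _) _).symm.trans
    ((built_vrCells_Fle m n).pHEq_wedge (singleton_mem_vrCells_Fle m n))

end Final

/-- For `m ≥ n > 2`, with `t_n = Σ_{A ⊆ [m], |A| = n} r_A`,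
`VR(F^m_{≤n}, 2) ≃ (∨_{t_n} S³) ∨ VR(F^m_{≤n-1}, 2)`; consequently `VR(F^m_{≤n}, 2)` is
homotopy equivalent to a wedge of `Σ_{k=3}^{n} t_k` copies of `S³`. -/
theorem stmt15 (m n : ℕ) (hn : 2 < n) (hnm : n ≤ m) :
    (∃ y : (VRc (Fle m (n - 1)) 2).space,
      Nonempty (ContinuousMap.HomotopyEquiv ((VRc (Fle m n) 2).space)
        (Wedge2 (WedgeSph 3 (tN m n)) ((VRc (Fle m (n - 1)) 2).space)
          (wedgeSphPt 3 (tN m n)) y))) ∧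
    AbsSC.HEquivTop (VRc (Fle m n) 2) (WedgeSph 3 (∑ k ∈ Finset.Icc 3 n, tN m k)) := by
  have h := pHEq_space_wedge m n (by omega)
  refine ⟨⟨emptyVertex m (n - 1), ?_⟩, h.nonempty_homotopyEquiv⟩
  have hsum : ∑ k ∈ Icc 3 n, tN m k = tN m n + ∑ k ∈ Icc 3 (n - 1), tN m k := by
    obtain ⟨k, rfl⟩ : ∃ k, n = k + 1 := ⟨n - 1, by omega⟩
    rw [sum_Icc_succ_top (by omega), add_comm, Nat.add_sub_cancel]
  rw [hsum] at h
  refine PHEq.nonempty_homotopyEquiv (h.trans (z := wedgeInl _ _ (wedgeSphPt 3 (tN m n))) ?_)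
  exact (PHEq.of_homeomorph (wedgeAddHomeomorph _ _ _) _).trans
    ((pHEq_space_wedge m (n - 1) (by omega)).symm.wedge2 _)
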